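/- Let f ∈ ℝ[x₁,…,xₙ], let h = (h₁,…,h_{m₁}), g = (g₁,…,g_{m₂}) be tuples of polynomials, and let h′ = (h′₁,…,h′_r) be another tuple of polynomials such that V_ℝ(h) = V_ℝ(h′). Suppose I(K) = I(V_ℝ(h)), where K is the feasible set. Then the Lasserre sequence {f_k} (using the equalities h) has finite convergence to f_min if and only if the Lasserre sequence {f′_k} (using the equalities h′ in place of h, with the same g) has finite convergence to f_min. -/

import Mathlib

open MvPolynomial Pointwise

/-- A polynomial is a sum of squares. -/
def IsSOS {n : ℕ} (p : MvPolynomial (Fin n) ℝ) : Prop :=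
  ∃ (m : ℕ) (q : Fin m → MvPolynomial (Fin n) ℝ), p = ∑ i, q i ^ 2

/-- The `2k`-th truncated ideal generated by the tuple `h`. -/
def truncIdeal {n m : ℕ} (h : Fin m → MvPolynomial (Fin n) ℝ) (k : ℕ) :
    Set (MvPolynomial (Fin n) ℝ) :=
  {p | ∃ φ : Fin m → MvPolynomial (Fin n) ℝ,
    (∀ i, (φ i * h i).totalDegree ≤ 2 * k) ∧ p = ∑ i, φ i * h i}

/-- The `k`-th truncated quadratic module generated by the tuple `g` (with `g₀ = 1`). -/
def truncQM {n m : ℕ} (g : Fin m → MvPolynomial (Fin n) ℝ) (k : ℕ) :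
    Set (MvPolynomial (Fin n) ℝ) :=
  {p | ∃ σ : Fin (m + 1) → MvPolynomial (Fin n) ℝ,
    (∀ j, IsSOS (σ j) ∧
      (σ j * (Fin.cons 1 g : Fin (m + 1) → MvPolynomial (Fin n) ℝ) j).totalDegree ≤ 2 * k) ∧
    p = ∑ j, σ j * (Fin.cons 1 g : Fin (m + 1) → MvPolynomial (Fin n) ℝ) j}

/-- The feasible set `K` of the problem `h = 0, g ≥ 0`. -/
def feasSet {n m₁ m₂ : ℕ} (h : Fin m₁ → MvPolynomial (Fin n) ℝ)
    (g : Fin m₂ → MvPolynomial (Fin n) ℝ) : Set (Fin n → ℝ) :=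
  {x | (∀ i, eval x (h i) = 0) ∧ ∀ j, 0 ≤ eval x (g j)}

/-- The real variety `V_ℝ(h)`. -/
def realVariety {n m : ℕ} (h : Fin m → MvPolynomial (Fin n) ℝ) : Set (Fin n → ℝ) :=
  {x | ∀ i, eval x (h i) = 0}

/-- The vanishing ideal `I(S)` of a set `S ⊆ ℝⁿ`. -/
def vanishIdeal {n : ℕ} (S : Set (Fin n → ℝ)) : Set (MvPolynomial (Fin n) ℝ) :=
  {p | ∀ u ∈ S, eval u p = 0}

/-- The `k`-th Lasserre bound `f_k` (an extended real). -/
noncomputable def lasserreBound {n m₁ m₂ : ℕ} (f : MvPolynomial (Fin n) ℝ)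
    (h : Fin m₁ → MvPolynomial (Fin n) ℝ) (g : Fin m₂ → MvPolynomial (Fin n) ℝ)
    (k : ℕ) : EReal :=
  sSup {γ : EReal | ∃ r : ℝ, γ = (r : EReal) ∧ f - C r ∈ truncIdeal h k + truncQM g k}

/-- `f_min`, the infimum of `f` over `K`, as an extended real (`⊤` if `K = ∅`). -/
noncomputable def fMin {n : ℕ} (f : MvPolynomial (Fin n) ℝ) (K : Set (Fin n → ℝ)) : EReal :=
  ⨅ x ∈ K, (eval x f : EReal)

namespace Polynomial

/-- The polynomial intermediate value property of an ordered field. -/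
def PolyIVT (R : Type*) [Field R] [LinearOrder R] : Prop :=
  ∀ (p : R[X]) (a b : R), a < b → p.eval a * p.eval b < 0 → ∃ c ∈ Set.Ioo a b, p.eval c = 0

theorem isSumSq_iff_exists_list {A : Type*} [CommRing A] {s : A} :
    IsSumSq s ↔ ∃ l : List A, s = (l.map (· ^ 2)).sum := by
  constructor
  · intro h
    induction h using IsSumSq.rec' with
    | zero => exact ⟨[], by simp⟩
    | sq_add hx hs ih =>
      obtain ⟨l, rfl⟩ := ih
      obtain ⟨y, rfl⟩ := hx
      exact ⟨y :: l, by simp [sq]⟩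
  · rintro ⟨l, rfl⟩
    induction l with
    | nil => simp
    | cons a l ih => simpa [sq] using (IsSumSq.mul_self a).add ih

theorem polyIVT_of_irreducible_dvd {E : Type*} [Field E] [LinearOrder E] [IsStrictOrderedRing E]
    (H : ∀ p : E[X], Irreducible p → (∀ c, p.eval c ≠ 0) →
      ∃ l : List E[X], p ∣ 1 + (l.map (· ^ 2)).sum) : PolyIVT E := by
  suffices ind : ∀ (d : ℕ) (p : E[X]), p.natDegree = d → ∀ (a b : E), a < b →
      p.eval a * p.eval b < 0 → ∃ c ∈ Set.Ioo a b, p.eval c = 0 from fun p => ind _ p rfl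
  intro d
  induction d using Nat.strong_induction_on with
  | _ d ih =>
  intro p hd a b hab hp
  have hp0 : p ≠ 0 := by rintro rfl; simp at hp
  have hpu : ¬ IsUnit p := by
    intro hu
    obtain ⟨c, -, rfl⟩ := isUnit_iff.1 hu
    simp only [eval_C] at hp
    nlinarith [mul_self_nonneg c]
  by_cases hirr : Irreducible p
  · by_cases hroot : ∃ c, p.eval c = 0
    · obtain ⟨c, hc⟩ := hroot
      obtain ⟨q, rfl⟩ := dvd_iff_isRoot.2 hc
      have hq : IsUnit q := (hirr.isUnit_or_isUnit rfl).resolve_left (not_isUnit_X_sub_C c)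
      obtain ⟨e, -, rfl⟩ := isUnit_iff.1 hq
      refine ⟨c, ?_, hc⟩
      simp only [eval_mul, eval_sub, eval_X, eval_C] at hp
      have : 0 < e * e := by
        have : e ≠ 0 := by rintro rfl; simp at hp
        exact mul_self_pos.2 this
      have h2 : (a - c) * (b - c) < 0 := by nlinarith
      rcases mul_neg_iff.1 h2 with h | h
      · linarith [h.1, h.2]
      · exact ⟨by linarith [h.1], by linarith [h.2]⟩
    · exfalso
      have hdeg : p.degree ≠ 0 := fun h => hpu (isUnit_iff_degree_eq_zero.2 h)
      push Not at hroot
      obtain ⟨l, hl⟩ := H p hirr hroot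
      set s : E[X] := 1 + ((l.map (· % p)).map (· ^ 2)).sum with hs
      have hdvd : p ∣ s := by
        refine (dvd_iff_dvd_of_dvd_sub ?_).1 hl
        rw [hs, add_sub_add_left_eq_sub]
        clear hs hl s
        induction l with
        | nil => simp
        | cons g l ih =>
          simp only [List.map_cons, List.sum_cons, add_sub_add_comm]
          refine dvd_add ?_ ih
          rw [sq_sub_sq]
          refine Dvd.dvd.mul_left ?_ _
          exact ⟨g / p, by linear_combination -(EuclideanDomain.mod_add_div g p)⟩
      have hpos : ∀ c : E, 0 < s.eval c := by
        intro c
        rw [hs, eval_add, eval_one, ← coe_evalRingHom, map_list_sum]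
        have : 0 ≤ (List.map (evalRingHom c) ((l.map (· % p)).map (· ^ 2))).sum := by
          apply List.sum_nonneg
          simp only [List.map_map, List.mem_map]
          rintro x ⟨g, -, rfl⟩
          simp only [Function.comp_apply, map_pow]
          positivity
        linarith
      have hdp : 0 < p.natDegree := by
        rw [Nat.pos_iff_ne_zero]
        exact fun h => hdeg (by rw [degree_eq_natDegree hp0, h]; rfl)
      have hsdeg : s.natDegree ≤ 2 * (p.natDegree - 1) := by
        rw [hs]
        refine (natDegree_add_le _ _).trans (max_le (by simp) ?_)
        refine (natDegree_list_sum_le _).trans (List.max_le_of_forall_le _ _ ?_)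
        simp only [List.mem_map]
        rintro _ ⟨_, ⟨_, ⟨g, -, rfl⟩, rfl⟩, rfl⟩
        refine natDegree_pow_le.trans ?_
        have : (g % p).natDegree < p.natDegree := natDegree_mod_lt g hdp.ne'
        omega
      obtain ⟨q, hq⟩ := hdvd
      have hs0 : s ≠ 0 := by intro h; have := hpos 0; simp [h] at this
      have hq0 : q ≠ 0 := by rintro rfl; exact hs0 (by simpa using hq)
      have hqd : q.natDegree < d := by
        rw [hq, natDegree_mul hp0 hq0] at hsdeg
        omega
      have h1 : 0 < p.eval a * q.eval a := by rw [← eval_mul, ← hq]; exact hpos a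
      have h2 : 0 < p.eval b * q.eval b := by rw [← eval_mul, ← hq]; exact hpos b
      have h3 : q.eval a * q.eval b < 0 := by
        by_contra! h
        nlinarith [mul_pos h1 h2, mul_nonneg_of_nonpos_of_nonpos hp.le (neg_nonpos.2 h)]
      obtain ⟨c, -, hc⟩ := ih _ hqd q rfl a b hab h3
      have := hpos c
      rw [hq, eval_mul, hc] at this
      simp at this
  · rw [irreducible_iff] at hirr
    push Not at hirr
    obtain ⟨u, v, huv, hu, hv⟩ := hirr hpu
    subst huv
    have hu0 : u ≠ 0 := left_ne_zero_of_mul hp0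
    have hv0 : v ≠ 0 := right_ne_zero_of_mul hp0
    have hud : u.natDegree ≠ 0 := fun h => hu (isUnit_iff_degree_eq_zero.2
      (by rw [degree_eq_natDegree hu0, h]; rfl))
    have hvd : v.natDegree ≠ 0 := fun h => hv (isUnit_iff_degree_eq_zero.2
      (by rw [degree_eq_natDegree hv0, h]; rfl))
    rw [natDegree_mul hu0 hv0] at hd
    simp only [eval_mul] at hp ⊢
    have : (u.eval a * u.eval b) * (v.eval a * v.eval b) < 0 := by linarith
    rcases mul_neg_iff.1 this with h | h
    · obtain ⟨c, hc, hc0⟩ := ih _ (by omega) v rfl a b hab h.2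
      exact ⟨c, hc, by simp [hc0]⟩
    · obtain ⟨c, hc, hc0⟩ := ih _ (by omega) u rfl a b hab h.1
      exact ⟨c, hc, by simp [hc0]⟩

variable {F Ω : Type*} [Field F] [Field Ω] [Algebra F Ω]

/-- `-1` is not a sum of squares of elements of the subfield `E`. -/
def IsRealSubfield (E : IntermediateField F Ω) : Prop :=
  ∀ l : List Ω, (∀ x ∈ l, x ∈ E) → 1 + (l.map (· ^ 2)).sum ≠ 0

theorem exists_maximal_isRealSubfield (hF : ∀ l : List F, 1 + (l.map (· ^ 2)).sum ≠ 0) :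
    ∃ E : IntermediateField F Ω, Maximal IsRealSubfield E := by
  suffices h : ∃ m, ⊥ ≤ m ∧ Maximal (· ∈ {E : IntermediateField F Ω | IsRealSubfield E}) m from
    let ⟨m, _, hm⟩ := h; ⟨m, hm⟩
  refine zorn_le_nonempty₀ _ ?_ _ ?_
  · intro c hc hchain y hy
    have hdir : DirectedOn (· ≤ ·) c := hchain.directedOn
    have : Nonempty c := ⟨⟨y, hy⟩⟩
    refine ⟨sSup c, ?_, fun z hz => le_sSup hz⟩
    intro l hl
    have hmem : ∀ x, x ∈ sSup c → ∃ E ∈ c, x ∈ E := by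
      intro x hx
      rw [sSup_eq_iSup', ← SetLike.mem_coe,
        IntermediateField.coe_iSup_of_directed hdir.directed_val] at hx
      simpa using hx
    have key : ∀ l : List Ω, (∀ x ∈ l, x ∈ sSup c) → ∃ E ∈ c, ∀ x ∈ l, x ∈ E := by
      intro l
      induction l with
      | nil => exact fun _ => ⟨y, hy, by simp⟩
      | cons a l ih =>
        intro h
        obtain ⟨E, hE, hEl⟩ := ih fun x hx => h x (by simp [hx])
        obtain ⟨E', hE', ha⟩ := hmem a (h a (by simp))
        obtain ⟨E'', hE'', h1, h2⟩ := hdir E hE E' hE'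
        refine ⟨E'', hE'', fun x hx => ?_⟩
        rcases List.mem_cons.1 hx with rfl | hx
        · exact h2 ha
        · exact h1 (hEl x hx)
    obtain ⟨E, hE, hEl⟩ := key l hl
    exact hc hE l hEl
  · intro l hl h0
    simp only [IntermediateField.mem_bot, Set.mem_range] at hl
    obtain ⟨l', rfl⟩ : ∃ l' : List F, l'.map (algebraMap F Ω) = l :=
      (Set.range_list_map _).symm.subset (fun x hx => by simpa using hl x hx)
    apply hF l'
    apply (algebraMap F Ω).injective
    simpa [map_list_sum, Function.comp_def] using h0

variable {E : IntermediateField F Ω}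

theorem IsRealSubfield.not_isSumSq_neg_one (hE : Maximal IsRealSubfield E) : ¬ IsSumSq (-1 : E) := by
  rw [isSumSq_iff_exists_list]
  rintro ⟨l, hl⟩
  refine hE.1 (l.map (algebraMap E Ω)) (by simp +contextual) ?_
  have := congrArg (algebraMap E Ω) hl
  simp only [map_neg, map_one, map_list_sum, List.map_map, Function.comp_def, map_pow] at this ⊢
  rw [← this]; ring

variable [Algebra.IsAlgebraic F Ω]

theorem IsRealSubfield.exists_list_of_notMem (hE : Maximal IsRealSubfield E) {α : Ω} (hα : α ∉ E) :
    ∃ l : List E[X], 1 + ((l.map (aeval α)).map (· ^ 2)).sum = 0 := by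
  by_contra! hcon
  have halg : IsAlgebraic E α := (Algebra.IsAlgebraic.isAlgebraic (R := F) α).tower_top E
  refine hα (hE.2 (y := (IntermediateField.adjoin E {α}).restrictScalars F) ?_ ?_ ?_)
  · intro l hl
    obtain ⟨l', rfl⟩ : ∃ l' : List E[X], l'.map (aeval α) = l := by
      refine (Set.range_list_map _).symm.subset (fun x hx => ?_)
      have h := hl x hx
      rw [IntermediateField.mem_restrictScalars, ← IntermediateField.mem_toSubalgebra,
        IntermediateField.adjoin_simple_toSubalgebra_of_isAlgebraic halg,
        Algebra.adjoin_singleton_eq_range_aeval] at h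
      exact h
    exact hcon l'
  · intro x hx
    rw [IntermediateField.mem_restrictScalars]
    exact (IntermediateField.adjoin E {α}).algebraMap_mem ⟨x, hx⟩
  · rw [IntermediateField.mem_restrictScalars]
    exact IntermediateField.mem_adjoin_simple_self E α

theorem IsRealSubfield.isSumSq_or_neg [IsAlgClosed Ω] (hE : Maximal IsRealSubfield E) (a : E) :
    IsSumSq a ∨ IsSumSq (-a) := by
  by_cases hsq : IsSquare a
  · exact .inl hsq.isSumSq
  right
  obtain ⟨α, hα⟩ := IsAlgClosed.exists_pow_nat_eq (algebraMap E Ω a) (n := 2) (by norm_num)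
  have hαE : α ∉ E := fun h => hsq ⟨⟨α, h⟩, by
    apply (algebraMap E Ω).injective
    rw [map_mul, ← hα, sq]; rfl⟩
  obtain ⟨l, hl⟩ := IsRealSubfield.exists_list_of_notMem hE hαE
  have key : ∀ l : List E[X], ∃ X Y Z : E, IsSumSq X ∧ IsSumSq Y ∧
      ((l.map (aeval α)).map (· ^ 2)).sum = algebraMap E Ω (X + a * Y) + algebraMap E Ω Z * α := by
    intro l
    induction l with
    | nil => exact ⟨0, 0, 0, by simp, by simp, by simp⟩
    | cons g l ih =>
      obtain ⟨A, B, Z, hA, hB, h⟩ := ih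
      obtain ⟨x, y, hxy⟩ : ∃ x y : E, aeval α g = algebraMap E Ω x + algebraMap E Ω y * α := by
        have hm : (X ^ 2 - C a : E[X]).Monic := monic_X_pow_sub_C a (by norm_num)
        have h0 : aeval α (X ^ 2 - C a : E[X]) = 0 := by simp [hα]
        have hd : (g %ₘ (X ^ 2 - C a)).natDegree ≤ 1 := by
          have := natDegree_modByMonic_lt g hm (by
            intro h; have := congrArg natDegree h; simp at this)
          rw [natDegree_X_pow_sub_C] at this
          omega
        have h1 := modByMonic_add_div g (X ^ 2 - C a : E[X])
        obtain ⟨y, x, hx⟩ := exists_eq_X_add_C_of_natDegree_le_one hd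
        refine ⟨x, y, ?_⟩
        rw [← h1, map_add, map_mul, h0, zero_mul, add_zero, hx]
        simp [add_comm]
      refine ⟨x * x + A, y * y + B, 2 * x * y + Z, (IsSumSq.mul_self x).add hA,
        (IsSumSq.mul_self y).add hB, ?_⟩
      simp only [List.map_cons, List.sum_cons, h, hxy]
      simp only [map_add, map_mul, map_ofNat]
      linear_combination (algebraMap E Ω y) ^ 2 * hα
  obtain ⟨A, B, Z, hA, hB, h⟩ := key l
  rw [h] at hl
  have hZ : Z = 0 := by
    by_contra hZ
    apply hαE
    have hZ' : algebraMap E Ω Z ≠ 0 := by simpa using hZ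
    have : α = algebraMap E Ω (-(1 + (A + a * B)) / Z) := by
      rw [map_div₀, eq_div_iff hZ']
      simp only [map_neg, map_add, map_one]
      simp only [map_add] at hl
      linear_combination hl
    rw [this]
    exact (-(1 + (A + a * B)) / Z).2
  have h1 : 1 + (A + a * B) = 0 := by
    apply (algebraMap E Ω).injective
    simpa [hZ] using hl
  have hB0 : B ≠ 0 := by
    rintro rfl
    exact IsRealSubfield.not_isSumSq_neg_one hE (by convert hA using 1; linear_combination -h1)
  have : -a = (1 + A) * B * (B⁻¹ * B⁻¹) := by
    field_simp
    linear_combination -h1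
  rw [this]
  exact ((IsSumSq.one.add hA).mul hB).mul (IsSumSq.mul_self _)

theorem IsRealSubfield.polyIVT [IsAlgClosed Ω] [LinearOrder E] [IsStrictOrderedRing E]
    (hE : Maximal IsRealSubfield E) : PolyIVT E := by
  refine polyIVT_of_irreducible_dvd fun p hirr hroot => ?_
  obtain ⟨α, hα⟩ := IsAlgClosed.exists_aeval_eq_zero Ω p hirr.degree_pos.ne'
  have hαE : α ∉ E := fun h => hroot ⟨α, h⟩ (by
    apply (algebraMap E Ω).injective
    rw [map_zero, ← hα, ← aeval_algebraMap_apply_eq_algebraMap_eval]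
    rfl)
  obtain ⟨l, hl⟩ := IsRealSubfield.exists_list_of_notMem hE hαE
  refine ⟨l, (dvd_or_isCoprime _ _ hirr).resolve_right ?_⟩
  rintro ⟨u, v, huv⟩
  have hsα : aeval α (1 + (l.map (· ^ 2)).sum) = 0 := by
    rw [← hl]
    simp [map_list_sum, Function.comp_def]
  have := congrArg (aeval α) huv
  simp only [map_add (aeval α) (u * p), map_mul (aeval α), hα, hsα] at this
  simp at this

theorem exists_polyIVT_extension (F : Type) [Field F]
    (hF : ∀ l : List F, 1 + (l.map (· ^ 2)).sum ≠ 0) :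
    ∃ (R : Type) (_ : Field R) (_ : LinearOrder R) (_ : IsStrictOrderedRing R) (_ : F →+* R),
      PolyIVT R := by
  classical
  obtain ⟨E, hE⟩ := exists_maximal_isRealSubfield (Ω := AlgebraicClosure F) hF
  let P : RingCone E :=
    { Subsemiring.sumSq E with
      eq_zero_of_mem_of_neg_mem' := by
        intro a ha hna
        replace ha : IsSumSq a := by simpa using ha
        replace hna : IsSumSq (-a) := by simpa using hna
        by_contra h0
        refine IsRealSubfield.not_isSumSq_neg_one hE ?_
        have : (-1 : E) = a * -a * (a⁻¹ * a⁻¹) := by field_simp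
        rw [this]
        exact (ha.mul hna).mul (IsSumSq.mul_self _) }
  have hP : HasMemOrNegMem P := ⟨fun a => by
    rcases IsRealSubfield.isSumSq_or_neg hE a with h | h
    · exact .inl (Subsemiring.mem_sumSq.2 h)
    · exact .inr (Subsemiring.mem_sumSq.2 h)⟩
  let _ : LinearOrder E := LinearOrder.mkOfAddGroupCone P
  have : IsOrderedRing E := IsOrderedRing.mkOfCone P
  have : IsStrictOrderedRing E := IsOrderedRing.toIsStrictOrderedRing E
  exact ⟨E, inferInstance, inferInstance, inferInstance, algebraMap F E, IsRealSubfield.polyIVT hE⟩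

section Rolle

variable {R : Type*} [Field R] [LinearOrder R] [IsStrictOrderedRing R]

theorem PolyIVT.sign_eq (hR : PolyIVT R) {p : R[X]} {a b : R}
    (h : ∀ x ∈ Set.uIcc a b, p.eval x ≠ 0) : SignType.sign (p.eval a) = SignType.sign (p.eval b) := by
  wlog hab : a < b generalizing a b
  · rcases eq_or_lt_of_not_gt hab with rfl | hab
    · rfl
    · exact (this (by rwa [Set.uIcc_comm]) hab).symm
  have ha := h a Set.left_mem_uIcc
  have hb := h b Set.right_mem_uIcc
  have hm : ¬ p.eval a * p.eval b < 0 := fun hlt => by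
    obtain ⟨c, hc, hc0⟩ := hR p a b hab hlt
    exact h c (Set.Icc_subset_uIcc (Set.Ioo_subset_Icc_self hc)) hc0
  rcases lt_or_gt_of_ne ha with ha | ha <;> rcases lt_or_gt_of_ne hb with hb | hb
  · rw [sign_neg ha, sign_neg hb]
  · exact absurd (mul_neg_of_neg_of_pos ha hb) hm
  · exact absurd (mul_neg_of_pos_of_neg ha hb) hm
  · rw [sign_pos ha, sign_pos hb]

theorem PolyIVT.exists_derivative_eq_zero_of_adjacent (hR : PolyIVT R) {p : R[X]} (hp : p ≠ 0)
    {a b : R} (hab : a < b) (ha : p.eval a = 0) (hb : p.eval b = 0)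
    (hne : ∀ x ∈ Set.Ioo a b, p.eval x ≠ 0) : ∃ c ∈ Set.Ioo a b, p.derivative.eval c = 0 := by
  obtain ⟨q, hq, hqa⟩ := exists_eq_pow_rootMultiplicity_mul_and_not_dvd p hp a
  have hm : 0 < p.rootMultiplicity a := (rootMultiplicity_pos hp).2 ha
  obtain ⟨m, hm⟩ : ∃ m, p.rootMultiplicity a = m + 1 := ⟨_, (Nat.succ_pred_eq_of_pos hm).symm⟩
  rw [hm] at hq
  have hq0 : q ≠ 0 := by rintro rfl; simp at hqa
  have hqb : q.eval b = 0 := by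
    rw [hq] at hb
    simpa [sub_eq_zero, hab.ne'] using hb
  obtain ⟨g, hg, hgb⟩ := exists_eq_pow_rootMultiplicity_mul_and_not_dvd q hq0 b
  have hk : 0 < q.rootMultiplicity b := (rootMultiplicity_pos hq0).2 hqb
  obtain ⟨k, hk⟩ : ∃ k, q.rootMultiplicity b = k + 1 := ⟨_, (Nat.succ_pred_eq_of_pos hk).symm⟩
  rw [hk] at hg
  have hga : g.eval a ≠ 0 := by
    intro h
    apply hqa
    rw [hg]
    exact (dvd_iff_isRoot.2 h).mul_left _
  have hgb : g.eval b ≠ 0 := fun h => hgb (dvd_iff_isRoot.2 h)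
  have hgne : ∀ x ∈ Set.uIcc a b, g.eval x ≠ 0 := by
    intro x hx hx0
    rw [Set.uIcc_of_le hab.le] at hx
    rcases eq_or_lt_of_le hx.1 with rfl | h1
    · exact hga hx0
    rcases eq_or_lt_of_le hx.2 with rfl | h2
    · exact hgb hx0
    exact hne x ⟨h1, h2⟩ (by rw [hq, hg]; simp [hx0])
  have hsign := hR.sign_eq hgne
  let r : R[X] := C ((m : R) + 1) * (X - C b) * g + C ((k : R) + 1) * (X - C a) * g +
    (X - C a) * (X - C b) * g.derivative
  have hder : p.derivative = (X - C a) ^ m * (X - C b) ^ k * r := by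
    rw [hq, hg]
    simp only [derivative_mul, derivative_X_sub_C_pow, Nat.add_sub_cancel, r]
    push_cast
    simp only [map_add, map_one, map_natCast]
    ring
  have hr : r.eval a * r.eval b < 0 := by
    have h1 : r.eval a = -((m + 1) * (b - a)) * g.eval a := by simp [r]; ring
    have h2 : r.eval b = ((k + 1) * (b - a)) * g.eval b := by simp [r]
    have h3 : 0 < g.eval a * g.eval b := by
      rw [← sign_eq_one_iff, sign_mul, hsign, ← sign_mul, sign_eq_one_iff]
      exact mul_self_pos.2 hgb
    have hba : 0 < b - a := sub_pos.2 hab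
    have : r.eval a * r.eval b =
      -((((m : R) + 1) * (b - a)) * (((k : R) + 1) * (b - a)) * (g.eval a * g.eval b)) := by
      rw [h1, h2]; ring
    rw [this, neg_lt_zero]
    positivity
  obtain ⟨c, hc, hc0⟩ := hR r a b hab hr
  exact ⟨c, hc, by rw [hder]; simp [hc0]⟩

theorem PolyIVT.exists_derivative_eq_zero (hR : PolyIVT R) {p : R[X]} {a b : R} (hab : a < b)
    (h : p.eval a = p.eval b) : ∃ c ∈ Set.Ioo a b, p.derivative.eval c = 0 := by
  classical
  wlog ha : p.eval a = 0 generalizing p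
  · simpa using this (p := p - C (p.eval a)) (by simp [h]) (by simp)
  rw [ha] at h
  by_cases hp : p = 0
  · obtain ⟨c, hc⟩ := exists_between hab
    exact ⟨c, hc, by simp [hp]⟩
  let S := p.roots.toFinset.filter (fun x => a < x ∧ x ≤ b)
  have hbS : b ∈ S := by simp [S, hp, hab, h.symm]
  have hS : S.Nonempty := ⟨b, hbS⟩
  have hmem := S.min'_mem hS
  simp only [S, Finset.mem_filter, Multiset.mem_toFinset, mem_roots hp] at hmem
  obtain ⟨hroot, h1, h2⟩ := hmem
  obtain ⟨c, hc, hc0⟩ := hR.exists_derivative_eq_zero_of_adjacent hp h1 ha hroot (by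
    intro x hx hx0
    refine absurd (S.min'_le x ?_) (not_le.2 hx.2)
    simp only [S, Finset.mem_filter, Multiset.mem_toFinset, mem_roots hp]
    exact ⟨hx0, hx.1, hx.2.le.trans h2⟩)
  exact ⟨c, ⟨hc.1, hc.2.trans_le h2⟩, hc0⟩

theorem PolyIVT.mul_neg_of_derivative_ne_zero (hR : PolyIVT R) {p : R[X]} {a b c : R}
    (hac : a < c) (hcb : c < b) (hc : p.eval c = 0)
    (hd : ∀ x ∈ Set.Ioo a b, p.derivative.eval x ≠ 0) : p.eval a * p.eval b < 0 := by
  have inj : ∀ x y, a ≤ x → x < y → y ≤ b → p.eval x ≠ p.eval y := by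
    intro x y hx hxy hy h
    obtain ⟨z, hz, hz0⟩ := hR.exists_derivative_eq_zero hxy h
    exact hd z ⟨hx.trans_lt hz.1, hz.2.trans_le hy⟩ hz0
  have ha : p.eval a ≠ 0 := fun h => inj a c le_rfl hac hcb.le (h.trans hc.symm)
  have hb : p.eval b ≠ 0 := fun h => inj c b hac.le hcb le_rfl (hc.trans h.symm)
  by_contra! hnn
  have hpos : 0 < p.eval a * p.eval b := lt_of_le_of_ne hnn (mul_ne_zero ha hb).symm
  have hab : p.eval a ≠ p.eval b := inj a b le_rfl (hac.trans hcb) le_rfl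
  have hlow : ∀ v, (0 - v) * (p.eval b - v) < 0 → p.eval a = v → False := by
    intro v hv hav
    obtain ⟨z, hz, hz0⟩ := hR (p - C v) c b hcb (by simpa [hc] using hv)
    refine inj a z le_rfl (hac.trans hz.1) hz.2.le ?_
    simp only [eval_sub, eval_C, sub_eq_zero] at hz0
    rw [hz0, hav]
  have hhigh : ∀ v, (p.eval a - v) * (0 - v) < 0 → p.eval b = v → False := by
    intro v hv hbv
    obtain ⟨z, hz, hz0⟩ := hR (p - C v) a c hac (by simpa [hc] using hv)
    refine inj z b hz.1.le (hz.2.trans hcb) le_rfl ?_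
    simp only [eval_sub, eval_C, sub_eq_zero] at hz0
    rw [hz0, hbv]
  rcases lt_or_gt_of_ne ha with ha' | ha'
  · have hb' : p.eval b < 0 := by
      by_contra! h; exact absurd hpos (not_lt.2 (mul_nonpos_of_nonpos_of_nonneg ha'.le h))
    rcases lt_or_gt_of_ne hab with h | h
    · exact hhigh _ (mul_neg_of_neg_of_pos (by linarith) (by linarith)) rfl
    · exact hlow _ (mul_neg_of_pos_of_neg (by linarith) (by linarith)) rfl
  · have hb' : 0 < p.eval b := by
      by_contra! h; exact absurd hpos (not_lt.2 (mul_nonpos_of_nonneg_of_nonpos ha'.le h))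
    rcases lt_or_gt_of_ne hab with h | h
    · exact hlow _ (mul_neg_of_neg_of_pos (by linarith) (by linarith)) rfl
    · exact hhigh _ (mul_neg_of_pos_of_neg (by linarith) (by linarith)) rfl

end Rolle

section TwoExtensions

theorem sign_map_of_strictMono {M R : Type*} [Field M] [LinearOrder M] [Field R] [LinearOrder R]
    {i : M →+* R} (hi : StrictMono i) (a : M) :
    SignType.sign (i a) = SignType.sign a := by
  rcases lt_trichotomy a 0 with h | rfl | h
  · rw [sign_neg h, sign_neg (by simpa using hi h)]
  · simp
  · rw [sign_pos h, sign_pos (by simpa using hi h)]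

theorem exists_adjacent {M R : Type*} [LinearOrder M] [LinearOrder R] (i : M → R)
    (S : Finset M) {y : R} (hy : ∀ s ∈ S, i s ≠ y)
    {u v : M} (hu : u ∈ S) (hv : v ∈ S) (huy : i u < y) (hyv : y < i v) :
    ∃ c ∈ S, ∃ d ∈ S, i c < y ∧ y < i d ∧ ∀ s ∈ S, ¬ (c < s ∧ s < d) := by
  classical
  have hA : (S.filter fun s => i s < y).Nonempty := ⟨u, by simp [hu, huy]⟩
  have hB : (S.filter fun s => y < i s).Nonempty := ⟨v, by simp [hv, hyv]⟩
  have h1 := Finset.max'_mem _ hA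
  have h2 := Finset.min'_mem _ hB
  rw [Finset.mem_filter] at h1 h2
  refine ⟨_, h1.1, _, h2.1, h1.2, h2.2, fun s hs hcs => ?_⟩
  rcases lt_or_gt_of_ne (hy s hs) with h | h
  · exact absurd (Finset.le_max' _ s (by simp [hs, h])) (not_le.2 hcs.1)
  · exact absurd (Finset.min'_le _ s (by simp [hs, h])) (not_le.2 hcs.2)

variable {M R₁ R₂ : Type*} [Field M] [LinearOrder M] [IsStrictOrderedRing M]
  [Field R₁] [LinearOrder R₁] [Field R₂] [LinearOrder R₂] [IsStrictOrderedRing R₂]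
  {i₁ : M →+* R₁} {i₂ : M →+* R₂}

theorem eval_map_ne_zero_of_forall (hR₁ : PolyIVT R₁) (hR₂ : PolyIVT R₂)
    (hi₁ : StrictMono i₁) (hi₂ : StrictMono i₂) {d : ℕ}
    (hd : ∀ p : M[X], p ≠ 0 → p.natDegree < d → ∀ x, (p.map i₁).eval x = 0 → x ∈ Set.range i₁)
    {p : M[X]} (hp : p ≠ 0) (hpd : p.natDegree ≤ d) {u v : M}
    (hne : ∀ x ∈ Set.Ioo (i₁ u) (i₁ v), (p.map i₁).eval x ≠ 0) :
    ∀ y ∈ Set.Ioo (i₂ u) (i₂ v), (p.map i₂).eval y ≠ 0 := by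
  classical
  induction hn : p.natDegree using Nat.strong_induction_on generalizing p u v with
  | _ n ih =>
  intro y hy hy0
  by_cases hn0 : p.natDegree = 0
  · rw [eq_C_of_natDegree_eq_zero hn0] at hy0 hp
    simp only [map_C, eval_C, map_eq_zero] at hy0
    simp [hy0] at hp
  have hder : p.derivative ≠ 0 := fun h => hn0 (derivative_eq_zero.1 h)
  have hderd : p.derivative.natDegree < p.natDegree := natDegree_derivative_lt hn0
  let S := insert u (insert v (p.derivative.roots.toFinset.filter fun s => u < s ∧ s < v))
  have huv : ∀ s ∈ S, u ≤ s ∧ s ≤ v := by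
    have huv : u ≤ v := (hi₂.lt_iff_lt.1 (hy.1.trans hy.2)).le
    intro s hs
    simp only [S, Finset.mem_insert, Finset.mem_filter] at hs
    rcases hs with rfl | rfl | ⟨-, h1, h2⟩
    · exact ⟨le_rfl, huv⟩
    · exact ⟨huv, le_rfl⟩
    · exact ⟨h1.le, h2.le⟩
  have hSy : ∀ s ∈ S, i₂ s ≠ y := by
    rintro s hs rfl
    have h1 := hi₂.lt_iff_lt.1 hy.1
    have h2 := hi₂.lt_iff_lt.1 hy.2
    refine hne (i₁ s) ⟨hi₁ h1, hi₁ h2⟩ ?_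
    rw [eval_map_apply] at hy0 ⊢
    simp only [map_eq_zero] at hy0
    simp [hy0]
  obtain ⟨c, hc, c', hc', hcy, hyc', hadj⟩ := exists_adjacent i₂ S hSy
    (u := u) (v := v) (by simp [S]) (by simp [S]) hy.1 hy.2
  have hcc : c < c' := hi₂.lt_iff_lt.1 (hcy.trans hyc')
  have hder1 : ∀ x ∈ Set.Ioo (i₁ c) (i₁ c'), (p.derivative.map i₁).eval x ≠ 0 := by
    intro x hx hx0
    obtain ⟨s, rfl⟩ := hd _ hder (by omega) x hx0
    have h1 := hi₁.lt_iff_lt.1 hx.1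
    have h2 := hi₁.lt_iff_lt.1 hx.2
    refine hadj s ?_ ⟨h1, h2⟩
    rw [eval_map_apply, map_eq_zero] at hx0
    simp only [S, Finset.mem_insert, Finset.mem_filter, Multiset.mem_toFinset, mem_roots hder]
    exact .inr (.inr ⟨hx0, (huv c hc).1.trans_lt h1, h2.trans_le (huv c' hc').2⟩)
  have hder2 := ih _ (by omega) hder (by omega) hder1 rfl
  have hlt := hR₂.mul_neg_of_derivative_ne_zero (p := p.map i₂) hcy hyc' hy0
    (by simpa only [derivative_map] using hder2)
  have hlt1 : (p.map i₁).eval (i₁ c) * (p.map i₁).eval (i₁ c') < 0 := by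
    rw [eval_map_apply, eval_map_apply, ← map_mul] at hlt ⊢
    rw [← sign_eq_neg_one_iff, sign_map_of_strictMono hi₂] at hlt
    rwa [← sign_eq_neg_one_iff, sign_map_of_strictMono hi₁]
  obtain ⟨x, hx, hx0⟩ := hR₁ _ _ _ (hi₁ hcc) hlt1
  exact hne x ⟨(hi₁.monotone (huv c hc).1).trans_lt hx.1,
    hx.2.trans_le (hi₁.monotone (huv c' hc').2)⟩ hx0

variable [IsStrictOrderedRing R₁]

theorem exists_bound_of_root (hi : StrictMono i₁) {f : M[X]} (hf : f ≠ 0) {t : R₁}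
    (ht : (f.map i₁).eval t = 0) : ∃ B : M, |t| < i₁ B := by
  wlog hmonic : f.Monic generalizing f
  · refine this (f := f * C f.leadingCoeff⁻¹) ?_ ?_ (monic_mul_leadingCoeff_inv hf)
    · simpa using hf
    · simp [ht]
  refine ⟨1 + ∑ j ∈ Finset.range f.natDegree, |f.coeff j|, ?_⟩
  by_contra! hcon
  have habs : ∀ a : M, i₁ |a| = |i₁ a| := fun a => by
    rcases le_total 0 a with h | h
    · rw [abs_of_nonneg h, abs_of_nonneg (by simpa using hi.monotone h)]
    · rw [abs_of_nonpos h, abs_of_nonpos (by simpa using hi.monotone h), map_neg]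
  simp only [map_add, map_one, map_sum, habs] at hcon
  set s := ∑ j ∈ Finset.range f.natDegree, |i₁ (f.coeff j)| with hs
  have hs0 : 0 ≤ s := Finset.sum_nonneg fun _ _ => abs_nonneg _
  have ht1 : 1 ≤ |t| := by linarith
  have hexp : t ^ f.natDegree = -∑ j ∈ Finset.range f.natDegree, i₁ (f.coeff j) * t ^ j := by
    rw [eval_map, eval₂_eq_sum_range, Finset.sum_range_succ, coeff_natDegree, hmonic] at ht
    simp only [map_one, one_mul] at ht
    linear_combination ht
  rcases Nat.eq_zero_or_pos f.natDegree with h0 | hpos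
  · rw [h0] at hexp; simp at hexp
  obtain ⟨k, hk⟩ : ∃ k, f.natDegree = k + 1 := ⟨_, (Nat.succ_pred_eq_of_pos hpos).symm⟩
  have hle : |t| ^ (k + 1) ≤ s * |t| ^ k := by
    rw [← abs_pow, ← hk, hexp, abs_neg, hs, Finset.sum_mul]
    refine (Finset.abs_sum_le_sum_abs _ _).trans (Finset.sum_le_sum fun j hj => ?_)
    rw [abs_mul, abs_pow]
    have : j ≤ k := by have := Finset.mem_range.1 hj; omega
    gcongr
  have hpk : 0 < |t| ^ k := by positivity
  rw [pow_succ, mul_comm] at hle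
  have := le_of_mul_le_mul_right hle hpk
  linarith

theorem exists_sign_eq_of_root (hR₁ : PolyIVT R₁) (hR₂ : PolyIVT R₂)
    (hi₁ : StrictMono i₁) (hi₂ : StrictMono i₂) {f : M[X]} (hf : f ≠ 0)
    (hd : ∀ p : M[X], p ≠ 0 → p.natDegree < f.natDegree →
      ∀ x, (p.map i₁).eval x = 0 → x ∈ Set.range i₁)
    {t : R₁} (ht : (f.map i₁).eval t = 0) (htM : t ∉ Set.range i₁) :
    ∃ s : R₂, ∀ p : M[X],
      SignType.sign ((p.map i₁).eval t) = SignType.sign ((p.map i₂).eval s) := by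
  classical
  have hf0 : f.natDegree ≠ 0 := by
    intro h
    rw [eq_C_of_natDegree_eq_zero h] at ht hf
    simp only [map_C, eval_C, map_eq_zero] at ht
    simp [ht] at hf
  suffices h : ∃ s : R₂, (f.map i₂).eval s = 0 ∧ ∀ p : M[X], p ≠ 0 → p.natDegree < f.natDegree →
      SignType.sign ((p.map i₁).eval t) = SignType.sign ((p.map i₂).eval s) by
    obtain ⟨s, hs, h⟩ := h
    refine ⟨s, fun p => ?_⟩
    rw [← EuclideanDomain.mod_add_div p f]
    simp only [Polynomial.map_add, Polynomial.map_mul, eval_add, eval_mul, ht, hs, zero_mul,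
      add_zero]
    by_cases h0 : p % f = 0
    · simp [h0]
    · exact h _ h0 (natDegree_mod_lt p hf0)
  by_contra! hcon
  choose! P hP0 hPd hP using hcon
  have hf2 : f.map i₂ ≠ 0 := by simpa using hf
  have hder : f.derivative ≠ 0 := fun h => hf0 (derivative_eq_zero.1 h)
  have hderd : f.derivative.natDegree < f.natDegree := natDegree_derivative_lt hf0
  obtain ⟨B, hB⟩ := exists_bound_of_root hi₁ hf ht
  let T : Finset M[X] := insert f.derivative ((f.map i₂).roots.toFinset.image P)
  let S : Finset M := insert (-B) (insert B (T.biUnion fun p => p.roots.toFinset))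
  have hT : ∀ p ∈ T, p ≠ 0 ∧ p.natDegree < f.natDegree := by
    intro p hp
    simp only [T, Finset.mem_insert, Finset.mem_image, Multiset.mem_toFinset, mem_roots hf2] at hp
    rcases hp with rfl | ⟨s, hs, rfl⟩
    · exact ⟨hder, hderd⟩
    · exact ⟨hP0 s hs, hPd s hs⟩
  obtain ⟨c, hc, c', hc', hct, htc', hadj⟩ := exists_adjacent i₁ S (y := t)
    (fun s _ hst => htM ⟨s, hst⟩) (u := -B) (v := B) (by simp [S]) (by simp [S])
    (by rw [map_neg]; exact (abs_lt.1 hB).1) (abs_lt.1 hB).2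
  have hcc : c < c' := hi₁.lt_iff_lt.1 (hct.trans htc')
  have hnoroot : ∀ p ∈ T, ∀ x ∈ Set.Ioo (i₁ c) (i₁ c'), (p.map i₁).eval x ≠ 0 := by
    intro p hp x hx hx0
    obtain ⟨s, rfl⟩ := hd p (hT p hp).1 (hT p hp).2 x hx0
    refine hadj s ?_ ⟨hi₁.lt_iff_lt.1 hx.1, hi₁.lt_iff_lt.1 hx.2⟩
    rw [eval_map_apply, map_eq_zero] at hx0
    simp only [S, Finset.mem_insert, Finset.mem_biUnion, Multiset.mem_toFinset]
    exact .inr (.inr ⟨p, hp, (mem_roots (hT p hp).1).2 hx0⟩)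
  have hlt := hR₁.mul_neg_of_derivative_ne_zero (p := f.map i₁) hct htc' ht
    (by simpa only [derivative_map] using hnoroot _ (Finset.mem_insert_self _ _))
  have hlt2 : (f.map i₂).eval (i₂ c) * (f.map i₂).eval (i₂ c') < 0 := by
    rw [eval_map_apply, eval_map_apply, ← map_mul] at hlt ⊢
    rw [← sign_eq_neg_one_iff, sign_map_of_strictMono hi₁] at hlt
    rwa [← sign_eq_neg_one_iff, sign_map_of_strictMono hi₂]
  obtain ⟨s, hs, hs0⟩ := hR₂ _ _ _ (hi₂ hcc) hlt2
  have hPT : P s ∈ T := by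
    simp only [T, Finset.mem_insert, Finset.mem_image, Multiset.mem_toFinset, mem_roots hf2]
    exact .inr ⟨s, hs0, rfl⟩
  have hno1 := hnoroot _ hPT
  have hno2 := eval_map_ne_zero_of_forall hR₁ hR₂ hi₁ hi₂ hd (hP0 s hs0) (hPd s hs0).le hno1
  obtain ⟨m, hm⟩ := exists_between hcc
  apply hP s hs0
  rw [hR₁.sign_eq (a := t) (b := i₁ m)
      (fun x hx => hno1 x (Set.ordConnected_Ioo.uIcc_subset ⟨hct, htc'⟩ ⟨hi₁ hm.1, hi₁ hm.2⟩ hx)),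
    hR₂.sign_eq (a := s) (b := i₂ m)
      (fun x hx => hno2 x (Set.ordConnected_Ioo.uIcc_subset hs ⟨hi₂ hm.1, hi₂ hm.2⟩ hx)),
    eval_map_apply, eval_map_apply, sign_map_of_strictMono hi₁, sign_map_of_strictMono hi₂]

theorem exists_sign_eq_of_finset (hR₁ : PolyIVT R₁) (hi₁ : StrictMono i₁)
    (hd : ∀ p : M[X], p ≠ 0 → ∀ x, (p.map i₁).eval x = 0 → x ∈ Set.range i₁)
    {t : R₁} (htM : t ∉ Set.range i₁) (P : Finset M[X]) :
    ∃ m : M, ∀ p ∈ P, SignType.sign ((p.map i₁).eval t) = SignType.sign (p.eval m) := by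
  classical
  let S : Finset M := P.biUnion fun p => p.roots.toFinset
  obtain ⟨m, hlo, hhi⟩ := Order.exists_between_finsets
    (S.filter fun s => i₁ s < t) (S.filter fun s => t < i₁ s) (by
      intro x hx y hy
      exact hi₁.lt_iff_lt.1 ((Finset.mem_filter.1 hx).2.trans (Finset.mem_filter.1 hy).2))
  refine ⟨m, fun p hp => ?_⟩
  by_cases hp0 : p = 0
  · simp [hp0]
  rw [hR₁.sign_eq (a := t) (b := i₁ m), eval_map_apply, sign_map_of_strictMono hi₁]
  intro x hx hx0
  obtain ⟨s, rfl⟩ := hd p hp0 x hx0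
  rw [eval_map_apply, map_eq_zero] at hx0
  have hsS : s ∈ S := Finset.mem_biUnion.2 ⟨p, hp, by simpa [hp0] using hx0⟩
  have hne : i₁ s ≠ t := fun h => htM ⟨s, h⟩
  rw [Set.mem_uIcc] at hx
  rcases lt_or_gt_of_ne hne with h | h
  · have := hi₁ (hlo s (by simp [hsS, h]))
    rcases hx with hx | hx
    · exact absurd hx.1 (not_le.2 h)
    · exact absurd hx.1 (not_le.2 this)
  · have := hi₁ (hhi s (by simp [hsS, h]))
    rcases hx with hx | hx
    · exact absurd hx.2 (not_le.2 this)
    · exact absurd hx.2 (not_le.2 h)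

end TwoExtensions

section SignCompat

variable {R₁ R₂ : Type*} [Field R₁] [LinearOrder R₁] [Field R₂] [LinearOrder R₂]

/-- A subring of `R₁ × R₂` is sign compatible if it is the graph of an order embedding. -/
def SignCompat (G : Subring (R₁ × R₂)) : Prop :=
  ∀ z ∈ G, SignType.sign z.1 = SignType.sign z.2

theorem SignCompat.exists_maximal {G₀ : Subring (R₁ × R₂)} (h : SignCompat G₀) :
    ∃ G, G₀ ≤ G ∧ Maximal SignCompat G := by
  refine zorn_le_nonempty₀ {G : Subring (R₁ × R₂) | SignCompat G} ?_ G₀ h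
  intro c hc hchain y hy
  refine ⟨sSup c, fun z hz => ?_, fun _ => le_sSup⟩
  obtain ⟨G, hG, hzG⟩ := (Subring.mem_sSup_of_directedOn ⟨y, hy⟩ hchain.directedOn).1 hz
  exact hc hG z hzG

theorem SignCompat.mem_of_maximal {G : Subring (R₁ × R₂)} (hG : Maximal SignCompat G)
    {z : R₁ × R₂} (h : ∀ p : G[X], SignType.sign (eval₂ G.subtype z p).1 =
      SignType.sign (eval₂ G.subtype z p).2) : z ∈ G := by
  refine hG.2 (y := (eval₂RingHom G.subtype z).range) ?_ ?_ ?_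
  · rintro _ ⟨p, rfl⟩
    exact h p
  · intro w hw
    exact ⟨C ⟨w, hw⟩, by simp⟩
  · exact ⟨X, by simp⟩

theorem SignCompat.snd_eq {G : Subring (R₁ × R₂)} (hG : SignCompat G) {a : R₁} {b b' : R₂}
    (hb : (a, b) ∈ G) (hb' : (a, b') ∈ G) : b = b' := by
  have := hG _ (sub_mem hb hb')
  simp only [Prod.mk_sub_mk, sub_self, sign_zero] at this
  exact sub_eq_zero.1 (sign_eq_zero_iff.1 this.symm)

variable [IsStrictOrderedRing R₁] [IsStrictOrderedRing R₂]

theorem SignCompat.inv_mem_of_maximal {G : Subring (R₁ × R₂)} (hG : Maximal SignCompat G)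
    {a : R₁} {b : R₂} (h : (a, b) ∈ G) : (a⁻¹, b⁻¹) ∈ G := by
  have hs : SignType.sign a = SignType.sign b := hG.1 _ h
  by_cases ha : a = 0
  · subst ha
    rw [sign_zero, eq_comm, sign_eq_zero_iff] at hs
    subst hs
    simpa using h
  have hb : b ≠ 0 := by
    rintro rfl
    rw [sign_zero, sign_eq_zero_iff] at hs
    exact ha hs
  refine SignCompat.mem_of_maximal hG fun p => ?_
  let _ : Invertible ((a⁻¹, b⁻¹) : R₁ × R₂) :=
    ⟨(a, b), by ext <;> simp [ha, hb], by ext <;> simp [ha, hb]⟩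
  have hinv : ⅟((a⁻¹, b⁻¹) : R₁ × R₂) = (a, b) := rfl
  rw [← eval₂_reverse_mul_pow, hinv]
  have hmem : eval₂ G.subtype (a, b) p.reverse ∈ G := by
    have : eval₂ G.subtype (a, b) p.reverse = G.subtype (p.reverse.eval ⟨(a, b), h⟩) := by
      rw [eval, hom_eval₂]
      rfl
    rw [this]
    exact Subtype.property _
  have hinvs : SignType.sign a⁻¹ = SignType.sign b⁻¹ := by
    rcases lt_or_gt_of_ne ha with h' | h'
    · rw [sign_neg h', eq_comm, sign_eq_neg_one_iff] at hs
      rw [sign_neg (inv_lt_zero.2 h'), sign_neg (inv_lt_zero.2 hs)]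
    · rw [sign_pos h', eq_comm, sign_eq_one_iff] at hs
      rw [sign_pos (inv_pos.2 h'), sign_pos (inv_pos.2 hs)]
  simp only [Prod.fst_mul, Prod.snd_mul, Prod.pow_fst, Prod.pow_snd, sign_mul, sign_pow, hinvs,
    hG.1 _ hmem]

/-- The projection to the first factor of a maximal sign compatible subring. -/
def SignCompat.fstSubfield {G : Subring (R₁ × R₂)} (hG : Maximal SignCompat G) : Subfield R₁ where
  __ := G.map (RingHom.fst R₁ R₂)
  inv_mem' := by
    rintro _ ⟨⟨a, b⟩, h, rfl⟩
    exact ⟨_, SignCompat.inv_mem_of_maximal hG h, rfl⟩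

theorem SignCompat.mem_fstSubfield {G : Subring (R₁ × R₂)} (hG : Maximal SignCompat G) {a : R₁} :
    a ∈ SignCompat.fstSubfield hG ↔ ∃ b, (a, b) ∈ G := by
  change a ∈ G.map (RingHom.fst R₁ R₂) ↔ _
  simp

theorem SignCompat.exists_embedding_of_maximal {G : Subring (R₁ × R₂)}
    (hG : Maximal SignCompat G) :
    ∃ i₂ : SignCompat.fstSubfield hG →+* R₂, StrictMono i₂ ∧
      ∀ a : SignCompat.fstSubfield hG, ((a : R₁), i₂ a) ∈ G := by
  choose b hb using fun a : SignCompat.fstSubfield hG => (SignCompat.mem_fstSubfield hG).1 a.2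
  refine ⟨⟨⟨⟨b, ?_⟩, ?_⟩, ?_, ?_⟩, ?_, hb⟩
  · exact hG.1.snd_eq (hb 1) (one_mem G)
  · exact fun x y => hG.1.snd_eq (hb _) (mul_mem (hb x) (hb y))
  · exact hG.1.snd_eq (hb 0) (zero_mem G)
  · exact fun x y => hG.1.snd_eq (hb _) (add_mem (hb x) (hb y))
  · intro x y hxy
    have h := hG.1 _ (sub_mem (hb y) (hb x))
    simp only [Prod.mk_sub_mk] at h
    rw [sign_pos (sub_pos.2 (by exact_mod_cast hxy)), eq_comm, sign_eq_one_iff, sub_pos] at h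
    exact h

theorem SignCompat.mem_of_sign_eq {G : Subring (R₁ × R₂)} (hG : Maximal SignCompat G)
    {i₂ : SignCompat.fstSubfield hG →+* R₂}
    (hi₂ : ∀ a : SignCompat.fstSubfield hG, ((a : R₁), i₂ a) ∈ G) {t : R₁} {s : R₂}
    (h : ∀ p : (SignCompat.fstSubfield hG)[X],
      SignType.sign ((p.map (SignCompat.fstSubfield hG).subtype).eval t) =
        SignType.sign ((p.map i₂).eval s)) : (t, s) ∈ G := by
  refine SignCompat.mem_of_maximal hG fun p => ?_
  let j : G →+* SignCompat.fstSubfield hG :=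
    ((RingHom.fst R₁ R₂).comp G.subtype).codRestrict _
      fun z => (SignCompat.mem_fstSubfield hG).2 ⟨z.1.2, z.2⟩
  have hj : i₂.comp j = (RingHom.snd R₁ R₂).comp G.subtype := by
    ext z
    exact hG.1.snd_eq (hi₂ (j z)) z.2
  have h1 : (eval₂ G.subtype (t, s) p).1 =
      ((p.map j).map (SignCompat.fstSubfield hG).subtype).eval t := by
    rw [Polynomial.map_map, eval_map]
    exact hom_eval₂ p G.subtype (RingHom.fst R₁ R₂) (t, s)
  have h2 : (eval₂ G.subtype (t, s) p).2 = ((p.map j).map i₂).eval s := by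
    rw [Polynomial.map_map, eval_map, hj]
    exact hom_eval₂ p G.subtype (RingHom.snd R₁ R₂) (t, s)
  rw [h1, h2, h]

theorem SignCompat.exists_embedding (hR₁ : PolyIVT R₁) (hR₂ : PolyIVT R₂)
    {G₀ : Subring (R₁ × R₂)} (hG₀ : SignCompat G₀) :
    ∃ (M : Subfield R₁) (i₂ : M →+* R₂), StrictMono i₂ ∧
      (∀ a b, (a, b) ∈ G₀ → ∃ m : M, (m : R₁) = a ∧ i₂ m = b) ∧
      ∀ p : M[X], p ≠ 0 → ∀ x, (p.map M.subtype).eval x = 0 → x ∈ Set.range M.subtype := by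
  obtain ⟨G, hle, hG⟩ := hG₀.exists_maximal
  obtain ⟨i₂, hmono, hi₂⟩ := SignCompat.exists_embedding_of_maximal hG
  refine ⟨SignCompat.fstSubfield hG, i₂, hmono, ?_, ?_⟩
  · intro a b hab
    have ha : a ∈ SignCompat.fstSubfield hG := (SignCompat.mem_fstSubfield hG).2 ⟨b, hle hab⟩
    exact ⟨⟨a, ha⟩, rfl, hG.1.snd_eq (hi₂ ⟨a, ha⟩) (hle hab)⟩
  · intro p
    induction hn : p.natDegree using Nat.strong_induction_on generalizing p with
    | _ n ih =>
    intro hp x hx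
    by_contra hxM
    have hsub : StrictMono (SignCompat.fstSubfield hG).subtype := fun _ _ h => h
    obtain ⟨s, hs⟩ := exists_sign_eq_of_root hR₁ hR₂ hsub hmono hp
      (fun q hq hqd => ih _ (hn ▸ hqd) q rfl hq) hx hxM
    exact hxM ⟨⟨x, (SignCompat.mem_fstSubfield hG).2
      ⟨s, SignCompat.mem_of_sign_eq hG hi₂ hs⟩⟩, rfl⟩

end SignCompat

section Ultrapower

variable {ι : Type*} (U : Ultrafilter ι) {R : Type*} [Field R]

theorem germ_eval_map (P : (ι → R)[X]) (A : ι → R) :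
    (P.map (Filter.Germ.coeRingHom (U : Filter ι))).eval (A : (U : Filter ι).Germ R) =
      ((fun w => (P.map (Pi.evalRingHom _ w)).eval (A w) : ι → R) : (U : Filter ι).Germ R) := by
  have h1 : (fun w => (P.map (Pi.evalRingHom _ w)).eval (A w) : ι → R) = P.eval A := by
    funext w
    rw [eval_map]
    exact (hom_eval₂ P (RingHom.id _) (Pi.evalRingHom (fun _ => R) w) A).symm
  rw [h1, eval_map]
  exact (hom_eval₂ P (RingHom.id _) (Filter.Germ.coeRingHom (U : Filter ι)) A).symm

/-- The diagonal embedding of a field into an ultrapower. -/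
def germConst : R →+* (U : Filter ι).Germ R :=
  (Filter.Germ.coeRingHom (U : Filter ι)).comp (Pi.constRingHom ι R)

/-- Solvability of `p ≠ 0 ∧ q = 0` descends from `R` to `ℝ`. -/
def DescendsToReal (n : ℕ) (j : ℝ →+* R) : Prop :=
  ∀ p q : MvPolynomial (Fin n) ℝ,
    (∃ x : Fin n → R, MvPolynomial.eval₂ j x p ≠ 0 ∧ MvPolynomial.eval₂ j x q = 0) →
      ∃ x : Fin n → ℝ, MvPolynomial.eval x p ≠ 0 ∧ MvPolynomial.eval x q = 0

theorem germ_mvPolynomial_eval₂ {n : ℕ} (j : ℝ →+* R) (p : MvPolynomial (Fin n) ℝ)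
    (x : Fin n → ι → R) :
    MvPolynomial.eval₂ ((germConst U).comp j) (fun k => ((x k : ι → R) : (U : Filter ι).Germ R)) p =
      ((fun w => MvPolynomial.eval₂ j (fun k => x k w) p : ι → R) : (U : Filter ι).Germ R) := by
  have h1 : (fun w => MvPolynomial.eval₂ j (fun k => x k w) p : ι → R) =
      MvPolynomial.eval₂ ((Pi.constRingHom ι R).comp j) x p := by
    funext w
    exact (MvPolynomial.eval₂_comp_left (Pi.evalRingHom (fun _ => R) w)
      ((Pi.constRingHom ι R).comp j) x p).symm
  rw [h1]
  exact (MvPolynomial.eval₂_comp_left (Filter.Germ.coeRingHom (U : Filter ι))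
      ((Pi.constRingHom ι R).comp j) x p).symm

theorem PolyIVT.germ [LinearOrder R] (hR : PolyIVT R) : PolyIVT ((U : Filter ι).Germ R) := by
  intro p a b hab hp
  have hsurj : Function.Surjective
      (Filter.Germ.coeRingHom (U : Filter ι) : (ι → R) →+* (U : Filter ι).Germ R) :=
    Quotient.mk_surjective
  obtain ⟨P, rfl⟩ := map_surjective _ hsurj p
  induction a using Filter.Germ.inductionOn with | _ A =>
  induction b using Filter.Germ.inductionOn with | _ B =>
  rw [germ_eval_map, germ_eval_map] at hp
  have h1 : ∀ᶠ w in (U : Filter ι), A w < B w := Filter.Germ.coe_lt.1 hab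
  have h2 : ∀ᶠ w in (U : Filter ι), (P.map (Pi.evalRingHom _ w)).eval (A w) *
      (P.map (Pi.evalRingHom _ w)).eval (B w) < 0 := Filter.Germ.coe_lt.1 hp
  have h3 : ∀ w, ∃ c, A w < B w → (P.map (Pi.evalRingHom _ w)).eval (A w) *
      (P.map (Pi.evalRingHom _ w)).eval (B w) < 0 →
      c ∈ Set.Ioo (A w) (B w) ∧ (P.map (Pi.evalRingHom _ w)).eval c = 0 := by
    intro w
    by_cases h : A w < B w ∧ (P.map (Pi.evalRingHom _ w)).eval (A w) *
      (P.map (Pi.evalRingHom _ w)).eval (B w) < 0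
    · obtain ⟨c, hc⟩ := hR _ _ _ h.1 h.2
      exact ⟨c, fun _ _ => hc⟩
    · exact ⟨0, fun h1 h2 => absurd ⟨h1, h2⟩ h⟩
  choose c hc using h3
  refine ⟨(c : (U : Filter ι).Germ R), ⟨?_, ?_⟩, ?_⟩
  · exact Filter.Germ.coe_lt.2 (by filter_upwards [h1, h2] with w h h' using (hc w h h').1.1)
  · exact Filter.Germ.coe_lt.2 (by filter_upwards [h1, h2] with w h h' using (hc w h h').1.2)
  · rw [germ_eval_map]
    exact Filter.Germ.coe_eq.2 (by filter_upwards [h1, h2] with w h h' using (hc w h h').2)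

theorem DescendsToReal.germ {n : ℕ} {j : ℝ →+* R} (h : DescendsToReal n j) :
    DescendsToReal n ((germConst U).comp j) := by
  rintro p q ⟨x, hp, hq⟩
  have hx : ∀ k, ∃ y : ι → R, (y : (U : Filter ι).Germ R) = x k :=
    fun k => Quotient.exists_rep (x k)
  choose y hy using hx
  obtain rfl : (fun k => ((y k : ι → R) : (U : Filter ι).Germ R)) = x := by
    funext k
    exact hy k
  rw [germ_mvPolynomial_eval₂] at hp hq
  have hq' : ∀ᶠ w in (U : Filter ι), MvPolynomial.eval₂ j (fun k => y k w) q = 0 :=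
    Filter.Germ.coe_eq.1 hq
  have hp' : ∀ᶠ w in (U : Filter ι), MvPolynomial.eval₂ j (fun k => y k w) p ≠ 0 := by
    rw [Ultrafilter.eventually_not]
    exact fun h => hp (Filter.Germ.coe_eq.2 h)
  obtain ⟨w, hw⟩ := (hp'.and hq').exists
  exact h p q ⟨_, hw⟩

end Ultrapower

section Transfer

theorem polyIVT_real : PolyIVT ℝ := by
  intro p a b hab hp
  have hc : ContinuousOn (fun x => p.eval x) (Set.Icc a b) := p.continuous.continuousOn
  rcases mul_neg_iff.1 hp with ⟨ha, hb⟩ | ⟨ha, hb⟩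
  · obtain ⟨c, hc, h⟩ := intermediate_value_Ioo' hab.le hc ⟨hb, ha⟩
    exact ⟨c, hc, h⟩
  · obtain ⟨c, hc, h⟩ := intermediate_value_Ioo hab.le hc ⟨ha, hb⟩
    exact ⟨c, hc, h⟩

theorem descendsToReal_id (n : ℕ) : DescendsToReal n (RingHom.id ℝ) := fun _ _ h => h

variable {R₁ : Type} [Field R₁] [LinearOrder R₁] [IsStrictOrderedRing R₁]

theorem strictMono_of_real (i : ℝ →+* R₁) : StrictMono i := by
  refine (monotone_iff_map_nonneg i).2 (fun a ha => ?_) |>.strictMono_of_injective i.injective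
  rw [← Real.sq_sqrt ha, map_pow]
  exact sq_nonneg _

/-- Any finite subset of `R₁` lies in an ordered subring containing `ℝ` that embeds into an ordered
field from which solvability descends to `ℝ`. -/
theorem exists_signCompat (n : ℕ) (hR₁ : PolyIVT R₁) (i : ℝ →+* R₁) (T : Finset R₁) :
    ∃ (R₂ : Type) (_ : Field R₂) (_ : LinearOrder R₂) (_ : IsStrictOrderedRing R₂)
      (j : ℝ →+* R₂) (G : Subring (R₁ × R₂)), PolyIVT R₂ ∧ DescendsToReal n j ∧ SignCompat G ∧
      (∀ r, (i r, j r) ∈ G) ∧ ∀ t ∈ T, ∃ s, (t, s) ∈ G := by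
  classical
  induction T using Finset.induction_on with
  | empty =>
    refine ⟨ℝ, inferInstance, inferInstance, inferInstance, RingHom.id ℝ,
      (i.prod (RingHom.id ℝ)).range, polyIVT_real, descendsToReal_id n, ?_,
      fun r => ⟨r, rfl⟩, by simp⟩
    rintro _ ⟨r, rfl⟩
    exact sign_map_of_strictMono (strictMono_of_real i) r
  | insert t T _ ih =>
    obtain ⟨R₂, _, _, _, j, G, hR₂, hj, hG, hr, hT⟩ := ih
    obtain ⟨M, i₂, hi₂, hMG, hM⟩ := SignCompat.exists_embedding hR₁ hR₂ hG
    have hsub : StrictMono M.subtype := fun _ _ h => h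
    by_cases ht : t ∈ M
    · refine ⟨R₂, _, _, inferInstance, j, (M.subtype.prod i₂).range, hR₂, hj, ?_, ?_, ?_⟩
      · rintro _ ⟨m, rfl⟩
        exact (sign_map_of_strictMono hsub m).trans (sign_map_of_strictMono hi₂ m).symm
      · intro r
        obtain ⟨m, h1, h2⟩ := hMG _ _ (hr r)
        exact ⟨m, Prod.ext h1 h2⟩
      · intro t' ht'
        rcases Finset.mem_insert.1 ht' with rfl | ht'
        · exact ⟨i₂ ⟨t', ht⟩, ⟨t', ht⟩, rfl⟩
        · obtain ⟨s, hs⟩ := hT t' ht'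
          obtain ⟨m, h1, h2⟩ := hMG _ _ hs
          exact ⟨s, m, Prod.ext h1 h2⟩
    · have htM : t ∉ Set.range M.subtype := by
        rintro ⟨m, rfl⟩
        exact ht m.2
      choose m hm using exists_sign_eq_of_finset hR₁ hsub hM htM
      let U : Ultrafilter (Finset M[X]) := Ultrafilter.of Filter.atTop
      let s : (U : Filter (Finset M[X])).Germ R₂ := ((fun P => i₂ (m P) : Finset M[X] → R₂) : _)
      let φ : M →+* R₁ × (U : Filter (Finset M[X])).Germ R₂ :=
        M.subtype.prod ((germConst U).comp i₂)
      have hmem : ∀ a b, (a, b) ∈ G → (a, germConst U b) ∈ (eval₂RingHom φ (t, s)).range := by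
        intro a b hab
        obtain ⟨m, rfl, rfl⟩ := hMG _ _ hab
        exact ⟨C m, by simp [φ]⟩
      refine ⟨(U : Filter (Finset M[X])).Germ R₂, inferInstance, inferInstance, inferInstance,
        (germConst U).comp j, (eval₂RingHom φ (t, s)).range, hR₂.germ U, hj.germ U, ?_, ?_, ?_⟩
      · rintro _ ⟨p, rfl⟩
        have h1 : (eval₂RingHom φ (t, s) p).1 = (p.map M.subtype).eval t := by
          rw [eval_map]
          exact hom_eval₂ p φ (RingHom.fst _ _) (t, s)
        have h2 : (eval₂RingHom φ (t, s) p).2 =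
            ((fun P => i₂ (p.eval (m P)) : Finset M[X] → R₂) :
              (U : Filter (Finset M[X])).Germ R₂) := by
          have h3 : (fun P => i₂ (p.eval (m P)) : Finset M[X] → R₂) =
              eval₂ ((Pi.constRingHom (Finset M[X]) R₂).comp i₂) (fun P => i₂ (m P)) p := by
            funext P
            exact (hom_eval₂ p (RingHom.id _) i₂ (m P)).trans
              (hom_eval₂ p ((Pi.constRingHom (Finset M[X]) R₂).comp i₂)
                (Pi.evalRingHom (fun _ => R₂) P) (fun P => i₂ (m P))).symm
          rw [h3]
          exact (hom_eval₂ p φ (RingHom.snd _ _) (t, s)).trans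
            (hom_eval₂ p ((Pi.constRingHom (Finset M[X]) R₂).comp i₂)
              (Filter.Germ.coeRingHom (U : Filter (Finset M[X]))) (fun P => i₂ (m P))).symm
        rw [h1, h2]
        have hU : ∀ᶠ P in (U : Filter (Finset M[X])),
            SignType.sign ((p.map M.subtype).eval t) = SignType.sign (i₂ (p.eval (m P))) := by
          have : ∀ᶠ P in (Filter.atTop : Filter (Finset M[X])), p ∈ P := by
            filter_upwards [Filter.eventually_ge_atTop {p}] with P hP
            exact hP (Finset.mem_singleton_self p)
          filter_upwards [Ultrafilter.of_le _ this] with P hP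
          rw [hm P p hP, sign_map_of_strictMono hi₂]
        rcases lt_trichotomy ((p.map M.subtype).eval t) 0 with h | h | h
        · rw [sign_neg h, eq_comm, sign_eq_neg_one_iff]
          refine Filter.Germ.coe_lt.2 ?_
          filter_upwards [hU] with P hP
          rwa [sign_neg h, eq_comm, sign_eq_neg_one_iff] at hP
        · rw [h, sign_zero, eq_comm, sign_eq_zero_iff]
          refine Filter.Germ.coe_eq.2 ?_
          filter_upwards [hU] with P hP
          rwa [h, sign_zero, eq_comm, sign_eq_zero_iff] at hP
        · rw [sign_pos h, eq_comm, sign_eq_one_iff]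
          refine Filter.Germ.coe_lt.2 ?_
          filter_upwards [hU] with P hP
          rwa [sign_pos h, eq_comm, sign_eq_one_iff] at hP
      · exact fun r => hmem _ _ (hr r)
      · intro t' ht'
        rcases Finset.mem_insert.1 ht' with rfl | ht'
        · exact ⟨s, X, by simp⟩
        · obtain ⟨s', hs'⟩ := hT t' ht'
          exact ⟨_, hmem _ _ hs'⟩

end Transfer

end Polynomial

section RealNullstellensatz

/-- The monoid of elements `p ^ (2 * l) + σ` with `σ` a sum of squares. -/
def evenPowAddSumSq {A : Type*} [CommRing A] (p : A) : Submonoid A where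
  carrier := {s | ∃ (l : ℕ) (σ : A), IsSumSq σ ∧ s = p ^ (2 * l) + σ}
  one_mem' := ⟨0, 0, IsSumSq.zero, by simp⟩
  mul_mem' := by
    rintro _ _ ⟨l, σ, hσ, rfl⟩ ⟨l', σ', hσ', rfl⟩
    have hp : ∀ l : ℕ, IsSumSq (p ^ (2 * l)) := fun l => by
      rw [two_mul, pow_add]
      exact IsSumSq.mul_self _
    exact ⟨l + l', p ^ (2 * l) * σ' + σ * p ^ (2 * l') + σ * σ',
      (((hp l).mul hσ').add (hσ.mul (hp l'))).add (hσ.mul hσ'), by ring⟩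

theorem isSumSq_sum_map_sq {A : Type*} [CommRing A] (l : List A) :
    IsSumSq (l.map (· ^ 2)).sum :=
  Polynomial.isSumSq_iff_exists_list.2 ⟨l, rfl⟩

theorem Ideal.exists_real_prime {A : Type*} [CommRing A] {I : Ideal A} {p : A}
    (h : Disjoint (I : Set A) (evenPowAddSumSq p)) :
    ∃ J : Ideal A, J.IsPrime ∧ I ≤ J ∧ p ∉ J ∧
      ∀ (l : List A) (b : A), b ^ 2 + (l.map (· ^ 2)).sum ∈ J → b ∈ J := by
  obtain ⟨J, hIJ, hJ⟩ := zorn_le_nonempty₀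
    {J : Ideal A | Disjoint (J : Set A) (evenPowAddSumSq p)} (fun c hc hchain y hy => by
      refine ⟨sSup c, Set.disjoint_left.2 fun x hx => ?_, fun _ => le_sSup⟩
      obtain ⟨J, hJ, hxJ⟩ :=
        (Submodule.mem_sSup_of_directed ⟨y, hy⟩ hchain.directedOn).1 hx
      exact Set.disjoint_left.1 (hc hJ) hxJ) I h
  have hmax : ∀ J' : Ideal A, J < J' → ¬ Disjoint (J' : Set A) (evenPowAddSumSq p) :=
    fun _ => hJ.not_prop_of_gt
  have hdisj : ∀ x ∈ J, x ∉ evenPowAddSumSq p := fun x hx => Set.disjoint_left.1 hJ.1 hx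
  refine ⟨J, Ideal.isPrime_of_maximally_disjoint J _ hJ.1 hmax, hIJ, fun hp => ?_,
    fun l b hb => ?_⟩
  · exact hdisj (p ^ 2) (J.pow_mem_of_mem hp 2 two_pos) ⟨1, 0, IsSumSq.zero, by simp⟩
  · by_contra hbJ
    have hlt : J < J ⊔ Ideal.span {b} := by
      refine lt_of_le_of_ne le_sup_left fun heq => hbJ ?_
      rw [heq]
      exact Ideal.mem_sup_right (Ideal.mem_span_singleton_self b)
    obtain ⟨s, hs, hsS⟩ := Set.not_disjoint_iff.1 (hmax _ hlt)
    obtain ⟨y, hy, z, hz, rfl⟩ := Submodule.mem_sup.1 hs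
    obtain ⟨c, rfl⟩ := Ideal.mem_span_singleton'.1 hz
    obtain ⟨k, σ, hσ, hk⟩ := (evenPowAddSumSq p).mul_mem hsS hsS
    refine hdisj ((y + c * b) * (y + c * b) + c * c * (l.map (· ^ 2)).sum) ?_
      ⟨k, σ + c * c * (l.map (· ^ 2)).sum,
        hσ.add ((IsSumSq.mul_self c).mul (isSumSq_sum_map_sq l)), by rw [hk]; ring⟩
    have : (y + c * b) * (y + c * b) + c * c * (l.map (· ^ 2)).sum =
        y * (y + 2 * (c * b)) + c * c * (b ^ 2 + (l.map (· ^ 2)).sum) := by ring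
    rw [this]
    exact J.add_mem (J.mul_mem_right _ hy) (J.mul_mem_left _ hb)

theorem IsFractionRing.exists_common_denom {A B F : Type*} [CommRing A] [CommRing B] [IsDomain B]
    [Field F] [Algebra B F] [IsFractionRing B F] (q : A →+* B) (hq : Function.Surjective q)
    (l : List F) : ∃ (b : A) (l' : List A), q b ≠ 0 ∧
      l'.map (fun a => algebraMap B F (q a)) = l.map (algebraMap B F (q b) * ·) := by
  induction l with
  | nil => exact ⟨1, [], by simp, rfl⟩
  | cons x l ih =>
    obtain ⟨b, l', hb, hl⟩ := ih
    obtain ⟨u, v, hv, rfl⟩ := IsFractionRing.div_surjective B x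
    obtain ⟨u, rfl⟩ := hq u
    obtain ⟨v, rfl⟩ := hq v
    have hv0 : q v ≠ 0 := nonZeroDivisors.ne_zero hv
    have hv1 : algebraMap B F (q v) ≠ 0 := by
      rwa [Ne, FaithfulSMul.algebraMap_eq_zero_iff]
    refine ⟨v * b, b * u :: l'.map (v * ·), by simp [hb, hv0], ?_⟩
    have := congrArg (List.map (algebraMap B F (q v) * ·)) hl
    simp only [List.map_map, Function.comp_def] at this
    simp only [List.map_cons, List.map_map, Function.comp_def, map_mul, mul_assoc, this]
    congr 1
    field_simp

theorem one_add_sum_sq_ne_zero_of_real {A F : Type*} [CommRing A] {J : Ideal A} [J.IsPrime]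
    [Field F] [Algebra (A ⧸ J) F] [IsFractionRing (A ⧸ J) F]
    (hJ : ∀ (l : List A) (b : A), b ^ 2 + (l.map (· ^ 2)).sum ∈ J → b ∈ J) (l : List F) :
    1 + (l.map (· ^ 2)).sum ≠ 0 := by
  intro h0
  obtain ⟨b, l', hb, hl⟩ := IsFractionRing.exists_common_denom (F := F) (Ideal.Quotient.mk J)
    Ideal.Quotient.mk_surjective l
  refine hb (Ideal.Quotient.eq_zero_iff_mem.2 (hJ l' b ?_))
  rw [← Ideal.Quotient.eq_zero_iff_mem, ← FaithfulSMul.algebraMap_eq_zero_iff (A ⧸ J) F]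
  have h1 := congrArg (fun L : List F => (L.map (· ^ 2)).sum) hl
  simp only [List.map_map, Function.comp_def, mul_pow, List.sum_map_mul_left] at h1
  simp only [map_add, map_pow, map_list_sum, List.map_map, Function.comp_def, h1]
  rw [← mul_one_add, h0, mul_zero]

theorem real_nullstellensatz {n m : ℕ} (h : Fin m → MvPolynomial (Fin n) ℝ)
    (p : MvPolynomial (Fin n) ℝ)
    (hp : ∀ x : Fin n → ℝ, (∀ i, eval x (h i) = 0) → eval x p = 0) :
    ∃ (l : ℕ) (σ : MvPolynomial (Fin n) ℝ), IsSumSq σ ∧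
      p ^ (2 * l) + σ ∈ Ideal.span (Set.range h) := by
  classical
  by_contra hcon
  obtain ⟨J, hJ, hle, hpJ, hreal⟩ := Ideal.exists_real_prime
    (I := Ideal.span (Set.range h)) (p := p) (Set.disjoint_left.2 (by
      rintro _ hx ⟨l, σ, hσ, rfl⟩
      exact hcon ⟨l, σ, hσ, hx⟩))
  let F := FractionRing (MvPolynomial (Fin n) ℝ ⧸ J)
  obtain ⟨R₁, _, _, _, i, hR₁⟩ := Polynomial.exists_polyIVT_extension F
    (one_add_sum_sq_ne_zero_of_real hreal)
  let ψ : MvPolynomial (Fin n) ℝ →+* R₁ :=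
    i.comp ((algebraMap (MvPolynomial (Fin n) ℝ ⧸ J) F).comp (Ideal.Quotient.mk J))
  have hψ : ∀ q, ψ q = 0 ↔ q ∈ J := fun q => by
    simp only [ψ, RingHom.comp_apply, map_eq_zero]
    rw [FaithfulSMul.algebraMap_eq_zero_iff, Ideal.Quotient.eq_zero_iff_mem]
  obtain ⟨R₂, _, _, _, j, G, -, hdesc, hG, hGr, hGX⟩ :=
    Polynomial.exists_signCompat n hR₁ (ψ.comp C) (Finset.univ.image fun k => ψ (X k))
  choose s hs using fun k => hGX (ψ (X k)) (Finset.mem_image_of_mem _ (Finset.mem_univ k))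
  have hmem : ∀ q, (ψ q, MvPolynomial.eval₂ j s q) ∈ G := fun q => by
    induction q using MvPolynomial.induction_on with
    | C a => simpa using hGr a
    | add p q hp hq => simpa using add_mem hp hq
    | mul_X q k hq => simpa using mul_mem hq (hs k)
  have hzero : ∀ q, MvPolynomial.eval₂ j s q = 0 ↔ q ∈ J := fun q => by
    rw [← hψ, ← sign_eq_zero_iff, ← hG _ (hmem q), sign_eq_zero_iff]
  obtain ⟨x, hx, hx0⟩ := hdesc p (∑ i, h i ^ 2) ⟨s, fun h0 => hpJ ((hzero p).1 h0),
    (hzero _).2 (J.sum_mem fun i _ => J.pow_mem_of_mem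
      (hle (Ideal.subset_span ⟨i, rfl⟩)) 2 two_pos)⟩
  refine hx (hp x fun i => ?_)
  rw [map_sum, Finset.sum_eq_zero_iff_of_nonneg fun i _ => by simp [sq_nonneg]] at hx0
  simpa using hx0 i (Finset.mem_univ i)

end RealNullstellensatz

section TruncatedCones

variable {n m₁ m₂ : ℕ} {h : Fin m₁ → MvPolynomial (Fin n) ℝ}
  {g : Fin m₂ → MvPolynomial (Fin n) ℝ} {k : ℕ} {p q : MvPolynomial (Fin n) ℝ}

theorem isSOS_iff_isSumSq : IsSOS p ↔ IsSumSq p := by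
  constructor
  · rintro ⟨m, q, rfl⟩
    exact IsSumSq.sum_sq _ q
  · rw [Polynomial.isSumSq_iff_exists_list]
    rintro ⟨l, rfl⟩
    refine ⟨l.length, l.get, ?_⟩
    rw [← List.sum_ofFn]
    exact congrArg List.sum (List.ofFn_getElem_eq_map l (· ^ 2)).symm

theorem isSumSq_C {a : ℝ} (ha : 0 ≤ a) : IsSumSq (C a : MvPolynomial (Fin n) ℝ) := by
  rw [← Real.mul_self_sqrt ha, map_mul]
  exact IsSumSq.mul_self _

theorem zero_mem_truncIdeal : (0 : MvPolynomial (Fin n) ℝ) ∈ truncIdeal h k :=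
  ⟨0, by simp, by simp⟩

theorem add_mem_truncIdeal (hp : p ∈ truncIdeal h k) (hq : q ∈ truncIdeal h k) :
    p + q ∈ truncIdeal h k := by
  obtain ⟨φ, hφ, rfl⟩ := hp
  obtain ⟨ψ, hψ, rfl⟩ := hq
  refine ⟨φ + ψ, fun i => ?_, by simp [add_mul, Finset.sum_add_distrib]⟩
  rw [Pi.add_apply, add_mul]
  exact (totalDegree_add _ _).trans (max_le (hφ i) (hψ i))

theorem totalDegree_C_mul_le (a : ℝ) (p : MvPolynomial (Fin n) ℝ) :
    (C a * p).totalDegree ≤ p.totalDegree := by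
  rw [C_mul']
  exact totalDegree_smul_le a p

theorem C_mul_mem_truncIdeal (a : ℝ) (hp : p ∈ truncIdeal h k) : C a * p ∈ truncIdeal h k := by
  obtain ⟨φ, hφ, rfl⟩ := hp
  refine ⟨fun i => C a * φ i, fun i => ?_, by simp [Finset.mul_sum, mul_assoc]⟩
  rw [mul_assoc]
  exact (totalDegree_C_mul_le _ _).trans (hφ i)

theorem truncIdeal_mono {l : ℕ} (hkl : k ≤ l) : truncIdeal h k ⊆ truncIdeal h l := by
  rintro _ ⟨φ, hφ, rfl⟩
  exact ⟨φ, fun i => (hφ i).trans (by lia), rfl⟩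

theorem exists_mem_truncIdeal (hp : p ∈ Ideal.span (Set.range h)) : ∃ k, p ∈ truncIdeal h k := by
  obtain ⟨φ, rfl⟩ := Ideal.mem_span_range_iff_exists_fun.1 hp
  refine ⟨Finset.univ.sup fun i => (φ i * h i).totalDegree, φ, fun i => ?_, rfl⟩
  have := Finset.le_sup (f := fun i => (φ i * h i).totalDegree) (Finset.mem_univ i)
  lia

theorem totalDegree_le_of_mem_truncIdeal (hp : p ∈ truncIdeal h k) : p.totalDegree ≤ 2 * k := by
  obtain ⟨φ, hφ, rfl⟩ := hp
  exact totalDegree_finsetSum_le fun i _ => hφ i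

theorem eval_eq_zero_of_mem_truncIdeal (hp : p ∈ truncIdeal h k) {x : Fin n → ℝ}
    (hx : ∀ i, eval x (h i) = 0) : eval x p = 0 := by
  obtain ⟨φ, -, rfl⟩ := hp
  simp [hx]

theorem zero_mem_truncQM : (0 : MvPolynomial (Fin n) ℝ) ∈ truncQM g k :=
  ⟨0, fun j => ⟨isSOS_iff_isSumSq.2 IsSumSq.zero, by simp⟩, by simp⟩

theorem add_mem_truncQM (hp : p ∈ truncQM g k) (hq : q ∈ truncQM g k) : p + q ∈ truncQM g k := by
  obtain ⟨σ, hσ, rfl⟩ := hp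
  obtain ⟨τ, hτ, rfl⟩ := hq
  refine ⟨σ + τ, fun j => ⟨?_, ?_⟩, by simp only [Pi.add_apply, add_mul, Finset.sum_add_distrib]⟩
  · exact isSOS_iff_isSumSq.2
      ((isSOS_iff_isSumSq.1 (hσ j).1).add (isSOS_iff_isSumSq.1 (hτ j).1))
  · rw [Pi.add_apply, add_mul]
    exact (totalDegree_add _ _).trans (max_le (hσ j).2 (hτ j).2)

theorem truncQM_mono {l : ℕ} (hkl : k ≤ l) : truncQM g k ⊆ truncQM g l := by
  rintro _ ⟨σ, hσ, rfl⟩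
  exact ⟨σ, fun j => ⟨(hσ j).1, (hσ j).2.trans (by lia)⟩, rfl⟩

theorem IsSumSq.mem_truncQM (hp : IsSumSq p) (hd : p.totalDegree ≤ 2 * k) : p ∈ truncQM g k := by
  refine ⟨Fin.cons p 0, fun j => ?_, by simp [Fin.sum_univ_succ]⟩
  induction j using Fin.cases with
  | zero => exact ⟨isSOS_iff_isSumSq.2 hp, by simpa using hd⟩
  | succ j => exact ⟨isSOS_iff_isSumSq.2 (by simp), by simp⟩

theorem eval_nonneg_of_mem_truncQM (hp : p ∈ truncQM g k) {x : Fin n → ℝ}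
    (hx : ∀ j, 0 ≤ eval x (g j)) : 0 ≤ eval x p := by
  obtain ⟨σ, hσ, rfl⟩ := hp
  rw [map_sum]
  refine Finset.sum_nonneg fun j _ => ?_
  rw [map_mul]
  refine mul_nonneg ?_ ?_
  · obtain ⟨m, q, hq⟩ := (hσ j).1
    rw [hq, map_sum]
    exact Finset.sum_nonneg fun i _ => by rw [map_pow]; exact sq_nonneg _
  · induction j using Fin.cases with
    | zero => simp
    | succ j => simpa using hx j

theorem add_mem_truncCone (hp : p ∈ truncIdeal h k + truncQM g k)
    (hq : q ∈ truncIdeal h k + truncQM g k) : p + q ∈ truncIdeal h k + truncQM g k := by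
  obtain ⟨a, ha, b, hb, rfl⟩ := hp
  obtain ⟨c, hc, d, hd, rfl⟩ := hq
  exact ⟨a + c, add_mem_truncIdeal ha hc, b + d, add_mem_truncQM hb hd, add_add_add_comm ..⟩

theorem truncCone_mono {l : ℕ} (hkl : k ≤ l) :
    truncIdeal h k + truncQM g k ⊆ truncIdeal h l + truncQM g l :=
  Set.add_subset_add (truncIdeal_mono hkl) (truncQM_mono hkl)

theorem mem_truncCone_of_mem_truncQM (hp : p ∈ truncQM g k) :
    p ∈ truncIdeal h k + truncQM g k :=
  ⟨0, zero_mem_truncIdeal, p, hp, zero_add p⟩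

theorem exists_smul_add_mem_of_sq
    (hq : ∃ k, ∀ c : ℝ, 0 ≤ c → ∀ ε > 0, C ε - C c * q ^ 2 ∈ truncIdeal h k + truncQM g k) :
    ∃ k, ∀ c : ℝ, ∀ ε > 0, C c * q + C ε ∈ truncIdeal h k + truncQM g k := by
  obtain ⟨k, hk⟩ := hq
  refine ⟨max k q.totalDegree, fun c ε hε => ?_⟩
  have hdeg : (C (ε / 2) * ((1 + C (c / ε) * q) * (1 + C (c / ε) * q))).totalDegree ≤
      2 * max k q.totalDegree := by
    have h1 : (1 + C (c / ε) * q).totalDegree ≤ q.totalDegree :=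
      (totalDegree_add _ _).trans (max_le (by simp) (totalDegree_C_mul_le _ _))
    have h2 := totalDegree_mul (1 + C (c / ε) * q) (1 + C (c / ε) * q)
    have h3 := totalDegree_C_mul_le (ε / 2) ((1 + C (c / ε) * q) * (1 + C (c / ε) * q))
    lia
  have hsos : IsSumSq (C (ε / 2) * ((1 + C (c / ε) * q) * (1 + C (c / ε) * q))) :=
    (isSumSq_C (by positivity)).mul (IsSumSq.mul_self _)
  have heq : C c * q + C ε = C (ε / 2) * ((1 + C (c / ε) * q) * (1 + C (c / ε) * q)) +
      (C (ε / 2) - C (c ^ 2 / (2 * ε)) * q ^ 2) := by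
    have e1 : (C c : MvPolynomial (Fin n) ℝ) = 2 * (C (ε / 2) * C (c / ε)) := by
      rw [← map_ofNat (C : ℝ →+* MvPolynomial (Fin n) ℝ), ← map_mul, ← map_mul]
      congr 1
      field_simp
    have e2 : (C (c ^ 2 / (2 * ε)) : MvPolynomial (Fin n) ℝ) =
        C (ε / 2) * (C (c / ε) * C (c / ε)) := by
      rw [← map_mul, ← map_mul]
      congr 1
      field_simp
    have e3 : (C ε : MvPolynomial (Fin n) ℝ) = C (ε / 2) + C (ε / 2) := by
      rw [← map_add, add_halves]
    rw [e1, e2, e3]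
    ring
  rw [heq]
  exact add_mem_truncCone (mem_truncCone_of_mem_truncQM (hsos.mem_truncQM hdeg))
    (truncCone_mono (le_max_left _ _) (hk _ (by positivity) _ (by positivity)))

theorem exists_smul_add_mem_of_two_pow (e : ℕ)
    (hq : ∃ k, ∀ c : ℝ, 0 ≤ c → ∀ ε > 0,
      C ε - C c * p ^ 2 ^ (e + 1) ∈ truncIdeal h k + truncQM g k) :
    ∃ k, ∀ c : ℝ, ∀ ε > 0, C c * p + C ε ∈ truncIdeal h k + truncQM g k := by
  induction e with
  | zero => exact exists_smul_add_mem_of_sq (by simpa using hq)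
  | succ e ih =>
    refine ih ?_
    obtain ⟨k, hk⟩ := exists_smul_add_mem_of_sq (q := p ^ 2 ^ (e + 1))
      (by simpa only [← pow_mul, ← pow_succ] using hq)
    exact ⟨k, fun c _ ε hε => by simpa [neg_add_eq_sub] using hk (-c) ε hε⟩

theorem exists_smul_add_mem_of_vanish
    (hp : ∀ x : Fin n → ℝ, (∀ i, eval x (h i) = 0) → eval x p = 0) :
    ∃ k, ∀ c : ℝ, ∀ ε > 0, C c * p + C ε ∈ truncIdeal h k + truncQM g k := by
  obtain ⟨l, σ, hσ, hmem⟩ := real_nullstellensatz h p hp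
  have hl : l ≤ 2 ^ l := Nat.lt_two_pow_self.le
  have hpow : p ^ 2 ^ (l + 1) = p ^ (2 * l) * (p ^ (2 ^ l - l) * p ^ (2 ^ l - l)) := by
    rw [← pow_add, ← pow_add]
    congr 1
    rw [pow_succ]
    lia
  set τ := σ * (p ^ (2 ^ l - l) * p ^ (2 ^ l - l)) with hτ
  have hτs : IsSumSq τ := hσ.mul (IsSumSq.mul_self _)
  have hmem' : p ^ 2 ^ (l + 1) + τ ∈ Ideal.span (Set.range h) := by
    rw [hpow, hτ, ← add_mul]
    exact Ideal.mul_mem_right _ _ hmem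
  obtain ⟨k, hk⟩ := exists_mem_truncIdeal hmem'
  refine exists_smul_add_mem_of_two_pow l ⟨max k τ.totalDegree, fun c hc ε hε => ?_⟩
  have heq : C ε - C c * p ^ 2 ^ (l + 1) =
      C (-c) * (p ^ 2 ^ (l + 1) + τ) + (C c * τ + C ε) := by
    rw [map_neg]
    ring
  rw [heq]
  refine ⟨_, C_mul_mem_truncIdeal _ (truncIdeal_mono (le_max_left _ _) hk), _, ?_, rfl⟩
  refine add_mem_truncQM (((isSumSq_C hc).mul hτs).mem_truncQM ?_)
    ((isSumSq_C hε.le).mem_truncQM (by simp))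
  have := totalDegree_C_mul_le c τ
  lia

theorem exists_add_mem_of_vanish (W : Submodule ℝ (MvPolynomial (Fin n) ℝ)) (hW : W.FG)
    (hvan : ∀ p ∈ W, ∀ x : Fin n → ℝ, (∀ i, eval x (h i) = 0) → eval x p = 0) :
    ∃ k, ∀ p ∈ W, ∀ ε > 0, p + C ε ∈ truncIdeal h k + truncQM g k := by
  induction W, hW using Submodule.fg_induction with
  | singleton p =>
    obtain ⟨k, hk⟩ := exists_smul_add_mem_of_vanish (g := g)
      (hvan p (Submodule.mem_span_singleton_self p))
    refine ⟨k, fun q hq ε hε => ?_⟩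
    obtain ⟨c, rfl⟩ := Submodule.mem_span_singleton.1 hq
    rw [← C_mul']
    exact hk c ε hε
  | sup W₁ W₂ _ _ h₁ h₂ =>
    obtain ⟨k₁, hk₁⟩ := h₁ fun p hp => hvan p (Submodule.mem_sup_left hp)
    obtain ⟨k₂, hk₂⟩ := h₂ fun p hp => hvan p (Submodule.mem_sup_right hp)
    refine ⟨max k₁ k₂, fun q hq ε hε => ?_⟩
    obtain ⟨a, ha, b, hb, rfl⟩ := Submodule.mem_sup.1 hq
    have heq : a + b + C ε = (a + C (ε / 2)) + (b + C (ε / 2)) := by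
      rw [add_add_add_comm, ← map_add, add_halves]
    rw [heq]
    exact add_mem_truncCone
      (truncCone_mono (le_max_left _ _) (hk₁ a ha _ (by positivity)))
      (truncCone_mono (le_max_right _ _) (hk₂ b hb _ (by positivity)))

end TruncatedCones

section Lasserre

variable {n m₁ m₂ r : ℕ} {f : MvPolynomial (Fin n) ℝ} {h : Fin m₁ → MvPolynomial (Fin n) ℝ}
  {g : Fin m₂ → MvPolynomial (Fin n) ℝ} {h' : Fin r → MvPolynomial (Fin n) ℝ}

/-- The polynomials vanishing on `V_ℝ(h)`, as a real subspace. -/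
def vanishSubmodule (h : Fin m₁ → MvPolynomial (Fin n) ℝ) :
    Submodule ℝ (MvPolynomial (Fin n) ℝ) where
  carrier := {p | ∀ x : Fin n → ℝ, (∀ i, eval x (h i) = 0) → eval x p = 0}
  zero_mem' := by simp
  add_mem' hp hq x hx := by rw [map_add, hp x hx, hq x hx, add_zero]
  smul_mem' c p hp x hx := by rw [smul_eval, hp x hx, mul_zero]

theorem exists_add_mem_of_mem_truncIdeal (hvar : realVariety h = realVariety h') (k : ℕ) :
    ∃ K, ∀ p ∈ truncIdeal h k, ∀ ε > 0, p + C ε ∈ truncIdeal h' K + truncQM g K := by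
  obtain ⟨K, hK⟩ := exists_add_mem_of_vanish (h := h') (g := g)
    (restrictTotalDegree (Fin n) ℝ (2 * k) ⊓ vanishSubmodule h')
    ((Submodule.fg_top _).1 (Module.Finite.of_injective (Submodule.inclusion inf_le_left)
      (Submodule.inclusion_injective _)).fg_top) fun p hp => hp.2
  refine ⟨K, fun p hp => hK p ⟨?_, fun x hx => ?_⟩⟩
  · exact (mem_restrictTotalDegree _ _ _).2 (totalDegree_le_of_mem_truncIdeal hp)
  · exact eval_eq_zero_of_mem_truncIdeal hp (hvar.symm.subset hx)

theorem lasserreBound_mono {k l : ℕ} (hkl : k ≤ l) :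
    lasserreBound f h g k ≤ lasserreBound f h g l :=
  sSup_le_sSup fun _ ⟨a, ha, hmem⟩ => ⟨a, ha, truncCone_mono hkl hmem⟩

theorem lasserreBound_le_fMin (k : ℕ) : lasserreBound f h g k ≤ fMin f (feasSet h g) := by
  refine sSup_le ?_
  rintro _ ⟨a, rfl, u, hu, v, hv, huv⟩
  refine le_iInf₂ fun x hx => ?_
  have h1 := congrArg (eval x) huv
  simp only [map_add, map_sub, eval_C, eval_eq_zero_of_mem_truncIdeal hu hx.1] at h1
  have h2 := eval_nonneg_of_mem_truncQM hv hx.2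
  exact EReal.coe_le_coe_iff.2 (by linarith)

theorem exists_lasserreBound_le (hvar : realVariety h = realVariety h') (k : ℕ) :
    ∃ K, lasserreBound f h g k ≤ lasserreBound f h' g K := by
  obtain ⟨K, hK⟩ := exists_add_mem_of_mem_truncIdeal (g := g) hvar k
  refine ⟨max K k, sSup_le ?_⟩
  rintro _ ⟨a, rfl, u, hu, v, hv, huv⟩
  refine EReal.ge_of_forall_gt_iff_ge.1 fun b hb => le_sSup ⟨b, rfl, ?_⟩
  have hba : 0 < a - b := sub_pos.2 (EReal.coe_lt_coe_iff.1 hb)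
  have heq : f - C b = (u + C (a - b)) + v := by
    rw [map_sub]
    linear_combination -huv
  rw [heq]
  exact add_mem_truncCone (truncCone_mono (le_max_left _ _) (hK u hu _ hba))
    (mem_truncCone_of_mem_truncQM (truncQM_mono (le_max_right _ _) hv))

theorem feasSet_eq (hvar : realVariety h = realVariety h') : feasSet h g = feasSet h' g := by
  ext x
  exact and_congr_left' (Set.ext_iff.1 hvar x)

theorem finite_convergence_of_realVariety_eq (hvar : realVariety h = realVariety h')
    (hconv : ∃ N : ℕ, ∀ k ≥ N, lasserreBound f h g k = fMin f (feasSet h g)) :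
    ∃ N : ℕ, ∀ k ≥ N, lasserreBound f h' g k = fMin f (feasSet h' g) := by
  obtain ⟨N, hN⟩ := hconv
  obtain ⟨K, hK⟩ := exists_lasserreBound_le (f := f) (g := g) hvar N
  refine ⟨K, fun k hk => le_antisymm (lasserreBound_le_fMin k) ?_⟩
  rw [← feasSet_eq hvar, ← hN N le_rfl]
  exact hK.trans (lasserreBound_mono hk)

end Lasserre

/-- If `V_ℝ(h) = V_ℝ(h')` and `I(K) = I(V_ℝ(h))`, then Lasserre's hierarchy using `h`
has finite convergence to `f_min` iff the one using `h'` does. -/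
theorem lasserre_finite_convergence_indep_of_defining_polys
    {n m₁ m₂ r : ℕ} (f : MvPolynomial (Fin n) ℝ)
    (h : Fin m₁ → MvPolynomial (Fin n) ℝ) (g : Fin m₂ → MvPolynomial (Fin n) ℝ)
    (h' : Fin r → MvPolynomial (Fin n) ℝ)
    (hvar : realVariety h = realVariety h')
    (hI : vanishIdeal (feasSet h g) = vanishIdeal (realVariety h)) :
    (∃ N : ℕ, ∀ k ≥ N, lasserreBound f h g k = fMin f (feasSet h g)) ↔
      (∃ N : ℕ, ∀ k ≥ N, lasserreBound f h' g k = fMin f (feasSet h g)) := by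
  have hfeas : feasSet h g = feasSet h' g := feasSet_eq hvar
  constructor
  · intro hconv
    rw [hfeas]
    exact finite_convergence_of_realVariety_eq hvar hconv
  · intro hconv
    rw [hfeas] at hconv
    exact finite_convergence_of_realVariety_eq hvar.symm hconv
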